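/- There exists a positive real constant C such that: for every ε > 0 there is an N so that for every integer n ≥ N there exists a simple graph G on n vertices which is triangle-free, has independence number α(G) ≤ C·√(n·log n), has maximum degree Δ(G) ≤ C·√(n·log n), and satisfies Δ(G) − δ(G) ≤ ε·√(n/log n), where Δ(G) and δ(G) denote the maximum and minimum degree of G. -/

import Mathlib

noncomputable section

namespace TwoBites

open Finset

open Classical in
/-- Expectation under the uniform distribution on a finite type. -/
def Ex {Ω : Type*} [Fintype Ω] (f : Ω → ℝ) : ℝ := (∑ ω, f ω) / (Fintype.card Ω : ℝ)

open Classical in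
/-- Probability under the uniform distribution on a finite type. -/
def Pr {Ω : Type*} [Fintype Ω] (s : Ω → Prop) : ℝ := Ex (fun ω => if s ω then (1 : ℝ) else 0)

section basics
variable {Ω : Type*} [Fintype Ω]

lemma Ex_mono {f g : Ω → ℝ} (h : ∀ ω, f ω ≤ g ω) : Ex f ≤ Ex g := by
  unfold Ex
  gcongr with ω
  exact h ω

lemma Ex_nonneg {f : Ω → ℝ} (h : ∀ ω, 0 ≤ f ω) : 0 ≤ Ex f := by
  unfold Ex
  have := Finset.sum_nonneg (fun ω (_ : ω ∈ (univ : Finset Ω)) => h ω)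
  positivity

lemma Ex_const [Nonempty Ω] (c : ℝ) : Ex (fun _ : Ω => c) = c := by
  unfold Ex
  have : (Fintype.card Ω : ℝ) ≠ 0 := by exact_mod_cast Fintype.card_ne_zero
  simp [this]

lemma Ex_le_of_le [Nonempty Ω] {f : Ω → ℝ} {c : ℝ} (h : ∀ ω, f ω ≤ c) : Ex f ≤ c := by
  calc Ex f ≤ Ex (fun _ : Ω => c) := Ex_mono h
    _ = c := Ex_const c

lemma Ex_mul_left (c : ℝ) (f : Ω → ℝ) : Ex (fun ω => c * f ω) = c * Ex f := by
  unfold Ex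
  rw [← Finset.mul_sum, mul_div_assoc]

lemma Ex_add (f g : Ω → ℝ) : Ex (fun ω => f ω + g ω) = Ex f + Ex g := by
  unfold Ex
  rw [Finset.sum_add_distrib, add_div]

lemma Ex_sum {ι : Type*} (S : Finset ι) (f : ι → Ω → ℝ) :
    Ex (fun ω => ∑ i ∈ S, f i ω) = ∑ i ∈ S, Ex (f i) := by
  unfold Ex
  rw [Finset.sum_comm, Finset.sum_div]

lemma Pr_nonneg (s : Ω → Prop) : 0 ≤ Pr s := Ex_nonneg (fun ω => by split_ifs <;> norm_num)

lemma Pr_le_Ex {s : Ω → Prop} {f : Ω → ℝ} (h0 : ∀ ω, 0 ≤ f ω) (h1 : ∀ ω, s ω → 1 ≤ f ω) :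
    Pr s ≤ Ex f := by
  refine Ex_mono (fun ω => ?_)
  split_ifs with h
  · exact h1 ω h
  · exact h0 ω

lemma Pr_mono {s t : Ω → Prop} (h : ∀ ω, s ω → t ω) : Pr s ≤ Pr t := by
  refine Ex_mono (fun ω => ?_)
  by_cases h1 : s ω
  · simp [h1, h ω h1]
  · simp only [h1, if_false]; split_ifs <;> norm_num

lemma Pr_or (s t : Ω → Prop) : Pr (fun ω => s ω ∨ t ω) ≤ Pr s + Pr t := by
  unfold Pr
  rw [← Ex_add]
  refine Ex_mono (fun ω => ?_)
  by_cases h1 : s ω <;> by_cases h2 : t ω <;> simp [h1, h2]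

open Classical in
lemma Pr_exists {ι : Type*} [Fintype ι] (s : ι → Ω → Prop) {b : ℝ} (h : ∀ i, Pr (s i) ≤ b) :
    Pr (fun ω => ∃ i, s i ω) ≤ Fintype.card ι * b := by
  calc Pr (fun ω => ∃ i, s i ω) ≤ Ex (fun ω => ∑ i, (if s i ω then (1 : ℝ) else 0)) := by
        refine Pr_le_Ex (fun ω => Finset.sum_nonneg (fun i _ => by split_ifs <;> norm_num)) ?_
        rintro ω ⟨i, hi⟩
        have := Finset.single_le_sum (f := fun i => (if s i ω then (1 : ℝ) else 0))
          (fun i _ => by split_ifs <;> norm_num) (Finset.mem_univ i)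
        simpa [hi] using this
    _ = ∑ i, Pr (s i) := Ex_sum _ _
    _ ≤ ∑ _i : ι, b := Finset.sum_le_sum (fun i _ => h i)
    _ = _ := by simp

lemma exists_of_Pr_lt_one [Nonempty Ω] {s : Ω → Prop} (h : Pr s < 1) : ∃ ω, ¬ s ω := by
  by_contra hc
  push Not at hc
  have : Pr s = 1 := by
    unfold Pr
    simp only [hc, if_true]
    exact Ex_const 1
  linarith

lemma Ex_equiv {Ω' : Type*} [Fintype Ω'] (e : Ω ≃ Ω') (f : Ω' → ℝ) :
    Ex (fun ω => f (e ω)) = Ex f := by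
  unfold Ex
  rw [Fintype.card_congr e, e.sum_comp]

lemma Pr_equiv {Ω' : Type*} [Fintype Ω'] (e : Ω ≃ Ω') (s : Ω' → Prop) :
    Pr (fun ω => s (e ω)) = Pr s := by
  unfold Pr
  exact Ex_equiv e (fun ω => @ite ℝ (s ω) (Classical.propDecidable _) 1 0)

lemma Ex_prod_type {Ω' : Type*} [Fintype Ω'] (f : Ω × Ω' → ℝ) :
    Ex f = Ex (fun ω' => Ex (fun ω => f (ω, ω'))) := by
  unfold Ex
  rw [Fintype.sum_prod_type_right, Fintype.card_prod, ← Finset.sum_div, div_div]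
  push_cast
  rfl

lemma Pr_prod_right {Ω' : Type*} [Fintype Ω'] [Nonempty Ω'] (s : Ω × Ω' → Prop) {b : ℝ}
    (h : ∀ ω', Pr (fun ω => s (ω, ω')) ≤ b) : Pr s ≤ b := by
  unfold Pr
  rw [Ex_prod_type]
  exact Ex_le_of_le h

lemma Pr_swap {Ω' : Type*} [Fintype Ω'] (s : Ω × Ω' → Prop) :
    Pr (fun x : Ω' × Ω => s x.swap) = Pr s := Pr_equiv (Equiv.prodComm Ω' Ω) s

lemma Pr_prod_left {Ω' : Type*} [Fintype Ω'] [Nonempty Ω] (s : Ω × Ω' → Prop) {b : ℝ}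
    (h : ∀ ω, Pr (fun ω' => s (ω, ω')) ≤ b) : Pr s ≤ b := by
  rw [← Pr_swap]
  exact Pr_prod_right _ h

end basics

section pi
variable {ι α : Type*} [Fintype ι] [DecidableEq ι] [Fintype α]

lemma Ex_pi_prod (f : ι → α → ℝ) :
    Ex (fun ω : ι → α => ∏ i, f i (ω i)) = ∏ i, Ex (f i) := by
  unfold Ex
  rw [Finset.prod_div_distrib, Finset.prod_univ_sum]
  simp

lemma Ex_pi_prod_finset [Nonempty α] (T : Finset ι) (f : ι → α → ℝ) :
    Ex (fun ω : ι → α => ∏ i ∈ T, f i (ω i)) = ∏ i ∈ T, Ex (f i) := by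
  have h := Ex_pi_prod (fun i a => if i ∈ T then f i a else 1)
  have h1 : ∀ ω : ι → α, ∏ i, (if i ∈ T then f i (ω i) else 1) = ∏ i ∈ T, f i (ω i) := by
    intro ω
    rw [Finset.prod_ite_mem]; simp
  simp only [h1] at h
  rw [h]
  have h2 : ∀ i, Ex (fun a => if i ∈ T then f i a else 1) = if i ∈ T then Ex (f i) else 1 := by
    intro i
    split_ifs
    · rfl
    · exact Ex_const 1
  simp only [h2]
  rw [Finset.prod_ite_mem]; simp

lemma Ex_pi_prod_inj [Nonempty α] {J : Type*} (S : Finset J) (φ : J → ι)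
    (hφ : Set.InjOn φ S) (f : J → α → ℝ) :
    Ex (fun ω : ι → α => ∏ j ∈ S, f j (ω (φ j))) = ∏ j ∈ S, Ex (f j) := by
  rcases S.eq_empty_or_nonempty with rfl | hne
  · simp [Ex_const]
  obtain ⟨j0, hj0⟩ := hne
  have : Nonempty J := ⟨j0⟩
  have h := Ex_pi_prod_finset (S.image φ) (fun i => f (Function.invFunOn φ S i))
  have key : ∀ j ∈ S, Function.invFunOn φ S (φ j) = j := fun j hj => by
    have h1 : ∃ a ∈ (S : Set J), φ a = φ j := ⟨j, hj, rfl⟩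
    exact hφ (Function.invFunOn_mem h1) hj (Function.invFunOn_eq h1)
  rw [Finset.prod_image hφ] at h
  simp only [Finset.prod_image hφ] at h
  rw [Finset.prod_congr rfl (fun j hj => by rw [key j hj])] at h
  rw [← h]
  congr 1
  ext ω
  exact Finset.prod_congr rfl (fun j hj => by rw [key j hj])

/-- Take coordinates in a set from the second argument, the others from the first. -/
def merge (J : ι → Prop) [DecidablePred J] (ω' ω : ι → α) : ι → α :=
  fun i => if J i then ω' i else ω i

lemma Ex_merge [Nonempty α] (J : ι → Prop) [DecidablePred J] (f : (ι → α) → ℝ) :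
    Ex f = Ex (fun ω' => Ex (fun ω => f (merge J ω' ω))) := by
  let e : ((ι → α) × (ι → α)) ≃ ((ι → α) × (ι → α)) :=
    { toFun := fun x => (merge J x.2 x.1, merge J x.1 x.2)
      invFun := fun x => (merge J x.2 x.1, merge J x.1 x.2)
      left_inv := fun x => by ext i <;> simp only [merge] <;> split_ifs <;> rfl
      right_inv := fun x => by ext i <;> simp only [merge] <;> split_ifs <;> rfl }
  rw [← Ex_prod_type (fun x : (ι → α) × (ι → α) => f (merge J x.2 x.1))]
  have := Ex_equiv e (fun x => f x.1)
  change Ex (fun x : (ι → α) × (ι → α) => f (merge J x.2 x.1)) = _ at this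
  rw [this, Ex_prod_type]
  simp [Ex_const]

lemma Pr_merge_le [Nonempty α] (J : ι → Prop) [DecidablePred J] (s : (ι → α) → Prop) {b : ℝ}
    (h : ∀ ω', Pr (fun ω => s (merge J ω' ω)) ≤ b) : Pr s ≤ b := by
  unfold Pr
  rw [Ex_merge J]
  exact Ex_le_of_le h

end pi

section bits
variable {ι : Type*} [Fintype ι] [DecidableEq ι] {q : ℕ}

lemma Ex_bit (u v : ℝ) :
    Ex (fun a : Fin (q + 1) => if a = 0 then u else v) = v + (1 / (q + 1 : ℝ)) * (u - v) := by
  unfold Ex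
  rw [Fin.sum_univ_succ]
  simp
  field_simp
  ring

lemma exp_bound {z : ℝ} (hz : |z| ≤ 1) : Real.exp z - 1 ≤ z + z ^ 2 := by
  have := Real.abs_exp_sub_one_sub_id_le hz
  have := (abs_le.mp this).2
  linarith

lemma mgf {J : Type*} (S : Finset J) (φ : J → ι) (hφ : Set.InjOn φ S) (m : J → ℝ) (Mx l p : ℝ)
    (hp : p = 1 / (q + 1 : ℝ)) (hm0 : ∀ j ∈ S, 0 ≤ m j) (hm : ∀ j ∈ S, m j ≤ Mx)
    (hl : |l| * Mx ≤ 1) :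
    Ex (fun ω : ι → Fin (q + 1) => Real.exp (l * ∑ j ∈ S, (if ω (φ j) = 0 then m j else 0)))
      ≤ Real.exp (l * (p * ∑ j ∈ S, m j) + l ^ 2 * p * Mx * ∑ j ∈ S, m j) := by
  have hp0 : 0 ≤ p := by rw [hp]; positivity
  have h1 : ∀ ω : ι → Fin (q + 1), Real.exp (l * ∑ j ∈ S, (if ω (φ j) = 0 then m j else 0))
      = ∏ j ∈ S, (fun j (a : Fin (q+1)) => if a = 0 then Real.exp (l * m j) else 1) j (ω (φ j)) := by
    intro ω
    rw [Finset.mul_sum, Real.exp_sum]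
    refine Finset.prod_congr rfl (fun j _ => ?_)
    dsimp only
    split_ifs <;> simp
  simp only [h1]
  rw [Ex_pi_prod_inj S φ hφ (fun j (a : Fin (q+1)) => if a = 0 then Real.exp (l * m j) else 1)]
  have h2 : l * (p * ∑ j ∈ S, m j) + l ^ 2 * p * Mx * ∑ j ∈ S, m j
      = ∑ j ∈ S, (l * p * m j + l ^ 2 * p * Mx * m j) := by
    rw [Finset.sum_add_distrib, ← Finset.mul_sum, ← Finset.mul_sum]; ring
  rw [h2, Real.exp_sum]
  refine Finset.prod_le_prod (fun j hj => Ex_nonneg fun a => by split_ifs <;> positivity)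
    (fun j hj => ?_)
  rw [Ex_bit, ← hp]
  have hmj := hm0 j hj
  have hb : Real.exp (l * m j) - 1 ≤ l * m j + (l * m j) ^ 2 := by
    apply exp_bound
    rw [abs_mul, abs_of_nonneg hmj]
    exact le_trans (mul_le_mul_of_nonneg_left (hm j hj) (abs_nonneg l)) hl
  have h3 : (l * m j) ^ 2 ≤ l ^ 2 * Mx * m j := by
    have : m j * m j ≤ Mx * m j := mul_le_mul_of_nonneg_right (hm j hj) hmj
    nlinarith [sq_nonneg l]
  calc 1 + p * (Real.exp (l * m j) - 1) ≤ 1 + p * (l * m j + l ^ 2 * Mx * m j) := by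
        gcongr; linarith
    _ = (l * p * m j + l ^ 2 * p * Mx * m j) + 1 := by ring
    _ ≤ _ := Real.add_one_le_exp _

lemma tail_upper {J : Type*} (S : Finset J) (φ : J → ι) (hφ : Set.InjOn φ S) (m : J → ℝ)
    (Mx l p t : ℝ) (hp : p = 1 / (q + 1 : ℝ)) (hm0 : ∀ j ∈ S, 0 ≤ m j) (hm : ∀ j ∈ S, m j ≤ Mx)
    (hl0 : 0 ≤ l) (hl : l * Mx ≤ 1) :
    Pr (fun ω : ι → Fin (q + 1) =>
        p * (∑ j ∈ S, m j) + t ≤ ∑ j ∈ S, (if ω (φ j) = 0 then m j else 0))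
      ≤ Real.exp (l ^ 2 * p * Mx * (∑ j ∈ S, m j) - l * t) := by
  have h := mgf (q := q) S φ hφ m Mx l p hp hm0 hm (by rwa [abs_of_nonneg hl0])
  have h1 := mul_le_mul_of_nonneg_left h (Real.exp_nonneg (-(l * (p * (∑ j ∈ S, m j) + t))))
  rw [← Ex_mul_left, ← Real.exp_add] at h1
  refine le_trans (Pr_le_Ex (fun ω => by positivity) (fun ω hω => ?_)) (le_trans h1 (le_of_eq ?_))
  · rw [← Real.exp_add]
    apply Real.one_le_exp
    nlinarith
  · congr 1; ring

lemma tail_lower {J : Type*} (S : Finset J) (φ : J → ι) (hφ : Set.InjOn φ S) (m : J → ℝ)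
    (Mx l p t : ℝ) (hp : p = 1 / (q + 1 : ℝ)) (hm0 : ∀ j ∈ S, 0 ≤ m j) (hm : ∀ j ∈ S, m j ≤ Mx)
    (hl0 : 0 ≤ l) (hl : l * Mx ≤ 1) :
    Pr (fun ω : ι → Fin (q + 1) =>
        ∑ j ∈ S, (if ω (φ j) = 0 then m j else 0) ≤ p * (∑ j ∈ S, m j) - t)
      ≤ Real.exp (l ^ 2 * p * Mx * (∑ j ∈ S, m j) - l * t) := by
  have h := mgf (q := q) S φ hφ m Mx (-l) p hp hm0 hm (by rwa [abs_neg, abs_of_nonneg hl0])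
  have h1 := mul_le_mul_of_nonneg_left h (Real.exp_nonneg (l * (p * (∑ j ∈ S, m j) - t)))
  rw [← Ex_mul_left, ← Real.exp_add] at h1
  refine le_trans (Pr_le_Ex (fun ω => by positivity) (fun ω hω => ?_)) (le_trans h1 (le_of_eq ?_))
  · rw [← Real.exp_add]
    apply Real.one_le_exp
    nlinarith
  · congr 1; ring

end bits

end TwoBites
end


noncomputable section

namespace TwoBites

open Finset

/-- Random bit matrices: an entry counts as active when it equals `0`. -/
abbrev Mat (r q : ℕ) := Fin r × Fin r → Fin (q + 1)

variable {r q a : ℕ}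

def adj (ω : Mat r q) (x y : Fin r) : Prop :=
  (y < x ∧ ω (x, y) = 0) ∨ (x < y ∧ ω (y, x) = 0)

def cl (ω : Mat r q) (x y : Fin r) : Prop := ∃ w, adj ω w x ∧ adj ω w y

def up (ω : Mat r q) (x y : Fin r) : Prop :=
  ∃ w, x < w ∧ y < w ∧ ω (w, x) = 0 ∧ ω (w, y) = 0

lemma adj_symm {ω : Mat r q} {x y : Fin r} (h : adj ω x y) : adj ω y x := by
  rcases h with h | h
  · exact Or.inr h
  · exact Or.inl h

lemma adj_irrefl {ω : Mat r q} {x : Fin r} (h : adj ω x x) : False := by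
  rcases h with h | h <;> exact lt_irrefl _ h.1

lemma cl_symm {ω : Mat r q} {x y : Fin r} (h : cl ω x y) : cl ω y x := by
  obtain ⟨w, h1, h2⟩ := h; exact ⟨w, h2, h1⟩

lemma up_symm {ω : Mat r q} {x y : Fin r} (h : up ω x y) : up ω y x := by
  obtain ⟨w, h1, h2, h3, h4⟩ := h; exact ⟨w, h2, h1, h4, h3⟩

lemma up_cl {ω : Mat r q} {x y : Fin r} (h : up ω x y) : cl ω x y := by
  obtain ⟨w, h1, h2, h3, h4⟩ := h
  exact ⟨w, Or.inl ⟨h1, h3⟩, Or.inl ⟨h2, h4⟩⟩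

open Classical in
lemma adapted (P : Finset (Fin r × Fin r)) (Op : Mat r q → Fin r × Fin r → Prop)
    (hOp : ∀ ω ω' e, (∀ e' : Fin r × Fin r, e.1 < e'.1 → ω e' = ω' e') → (Op ω e ↔ Op ω' e))
    (p : ℝ) (hp : p = 1 / (q + 1 : ℝ)) (hp1 : p < 1) :
    Ex (fun ω : Mat r q => ∏ e ∈ P, if Op ω e then (if ω e = 0 then 0 else (1 - p)⁻¹) else 1)
      ≤ 1 := by
  refine Finset.induction_on_min_value (Prod.fst) P ?_ ?_
  · simp [Ex_const]
  · intro e0 P he0 hmin ih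
    refine le_trans (le_of_eq ?_) ih
    simp only [Finset.prod_insert he0]
    rw [Ex_merge (fun e => e ≠ e0)]
    congr 1
    ext ω'
    have hG : ∀ ω : Mat r q, ∀ e ∈ P, (if Op (merge (fun e => e ≠ e0) ω' ω) e then
          (if (merge (fun e => e ≠ e0) ω' ω) e = 0 then (0:ℝ) else (1 - p)⁻¹) else 1)
        = (if Op ω' e then (if ω' e = 0 then 0 else (1 - p)⁻¹) else 1) := by
      intro ω e he
      have hne : e ≠ e0 := fun h => he0 (h ▸ he)
      have h1 : Op (merge (fun e => e ≠ e0) ω' ω) e ↔ Op ω' e := by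
        apply hOp
        intro e' he'
        have : e' ≠ e0 := by
          rintro rfl
          exact absurd (hmin e he) (not_le.mpr he')
        simp [merge, this]
      have h2 : merge (fun e => e ≠ e0) ω' ω e = ω' e := by simp [merge, hne]
      simp only [h1, h2]
    have hE : ∀ ω : Mat r q, Op (merge (fun e => e ≠ e0) ω' ω) e0 ↔ Op ω' e0 := by
      intro ω
      apply hOp
      intro e' he'
      have : e' ≠ e0 := by
        rintro rfl
        exact lt_irrefl _ he'
      simp [merge, this]
    have hM : ∀ ω : Mat r q, merge (fun e => e ≠ e0) ω' ω e0 = ω e0 := by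
      intro ω; simp [merge]
    have : ∀ ω : Mat r q, ((if Op (merge (fun e => e ≠ e0) ω' ω) e0 then
          (if (merge (fun e => e ≠ e0) ω' ω) e0 = 0 then (0:ℝ) else (1 - p)⁻¹) else 1) *
        ∏ e ∈ P, (if Op (merge (fun e => e ≠ e0) ω' ω) e then
          (if (merge (fun e => e ≠ e0) ω' ω) e = 0 then (0:ℝ) else (1 - p)⁻¹) else 1))
        = (∏ e ∈ P, (if Op ω' e then (if ω' e = 0 then 0 else (1 - p)⁻¹) else 1)) *
          (if Op ω' e0 then (if ω e0 = 0 then 0 else (1 - p)⁻¹) else 1) := by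
      intro ω
      rw [Finset.prod_congr rfl (hG ω), mul_comm]
      simp only [hE, hM]
    simp only [this]
    rw [Ex_mul_left]
    have h1 : Ex (fun ω : Mat r q => if Op ω' e0 then (if ω e0 = 0 then 0 else (1 - p)⁻¹) else 1)
        = 1 := by
      by_cases hO : Op ω' e0
      · simp only [hO, if_true]
        have h2 := Ex_pi_prod_finset (α := Fin (q+1)) {e0} (fun _ b => if b = 0 then 0 else (1 - p)⁻¹)
        simp only [Finset.prod_singleton] at h2
        rw [h2, Ex_bit, ← hp]
        have : 1 - p ≠ 0 := by linarith
        field_simp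
        ring
      · simp only [hO, if_false]
        exact Ex_const 1
    rw [h1, mul_one]

open Classical in
lemma alpha_one (P : Finset (Fin r × Fin r)) (hP : ∀ e ∈ P, e.2 < e.1) (m : ℕ)
    (p : ℝ) (hp : p = 1 / (q + 1 : ℝ)) (hp1 : p < 1) :
    Pr (fun ω : Mat r q => (∀ e ∈ P, ω e = 0 → up ω e.1 e.2) ∧
      m ≤ (P.filter (fun e => ¬ up ω e.1 e.2)).card) ≤ (1 - p) ^ m := by
  have hp0 : 0 ≤ p := by rw [hp]; positivity
  have hq : 0 < 1 - p := by linarith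
  have h := adapted P (fun ω e => e.2 < e.1 ∧ ¬ up ω e.1 e.2) (by
    intro ω ω' e hh
    refine and_congr_right (fun hlt => not_congr ?_)
    unfold up
    refine exists_congr (fun w => and_congr_right fun h1 => and_congr_right fun _ => ?_)
    rw [hh (w, e.1) h1, hh (w, e.2) h1]) p hp hp1
  have h1 : Ex (fun ω : Mat r q => (1 - p) ^ m * ∏ e ∈ P,
      if (e.2 < e.1 ∧ ¬ up ω e.1 e.2) then (if ω e = 0 then 0 else (1 - p)⁻¹) else 1)
      ≤ (1 - p) ^ m := by
    rw [Ex_mul_left]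
    refine mul_le_of_le_one_right (by positivity) ?_
    refine le_trans (le_of_eq ?_) h
    congr!
  refine le_trans (Pr_le_Ex (fun ω => ?_) (fun ω hω => ?_)) h1
  · refine mul_nonneg (by positivity) (Finset.prod_nonneg fun e _ => ?_)
    split_ifs <;> first | positivity | norm_num
  · obtain ⟨h2, h3⟩ := hω
    have h4 : (∏ e ∈ P, if (e.2 < e.1 ∧ ¬ up ω e.1 e.2) then
        (if ω e = 0 then 0 else (1 - p)⁻¹) else 1)
        = ∏ e ∈ P, if (¬ up ω e.1 e.2) then (1 - p)⁻¹ else 1 := by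
      refine Finset.prod_congr rfl (fun e he => ?_)
      by_cases hu : up ω e.1 e.2
      · simp [hu]
      · have : ω e ≠ 0 := fun h0 => hu (h2 e he h0)
        simp [hu, this, hP e he]
    rw [h4, ← Finset.prod_filter, Finset.prod_const]
    have h5 : (1 - p)⁻¹ ^ m ≤ (1 - p)⁻¹ ^ (P.filter (fun e => ¬ up ω e.1 e.2)).card := by
      apply pow_le_pow_right₀ _ h3
      rw [one_le_inv₀ hq]; linarith
    calc (1:ℝ) = (1 - p) ^ m * (1 - p)⁻¹ ^ m := by
          rw [← mul_pow, mul_inv_cancel₀ hq.ne', one_pow]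
      _ ≤ _ := by gcongr

open Classical in
/-- Number of indices `i` such that the matrix has an active entry at `(w, y i)`. -/
def D1 (ω : Mat r q) (y : Fin a → Fin r) (w : Fin r) : ℕ :=
  (univ.filter (fun i => ω (w, y i) = 0)).card

open Classical in
def ew (ω : Mat r q) (W : Finset (Fin r)) (y : Fin r) : ℕ :=
  (W.filter (fun w => ω (w, y) = 0)).card

open Classical in
def Mult (y : Fin a → Fin r) (Mx : ℝ) : Prop :=
  ∀ z, ((univ.filter (fun i => y i = z)).card : ℝ) ≤ Mx

open Classical in
lemma pair_bit (u v : Fin r) (p : ℝ) (hp : p = 1 / (q + 1 : ℝ)) :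
    Ex (fun ρ : Fin r → Fin (q + 1) => (if ρ u = 0 then (1:ℝ) else 0) * (if ρ v = 0 then 1 else 0))
      ≤ (if u = v then p else 0) + p ^ 2 := by
  have hp0 : 0 ≤ p := by rw [hp]; positivity
  by_cases huv : u = v
  · subst huv
    have h2 := Ex_pi_prod_finset (α := Fin (q+1)) {u} (fun _ b => if b = 0 then (1:ℝ) else 0)
    simp only [Finset.prod_singleton] at h2
    have : ∀ ρ : Fin r → Fin (q + 1), (if ρ u = 0 then (1:ℝ) else 0) * (if ρ u = 0 then 1 else 0)
        = if ρ u = 0 then (1:ℝ) else 0 := by intro ρ; split_ifs <;> simp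
    simp only [this]
    rw [h2, Ex_bit, ← hp]
    simp
    positivity
  · have h2 := Ex_pi_prod_finset (α := Fin (q+1)) {u, v} (fun _ b => if b = 0 then (1:ℝ) else 0)
    simp only [Finset.prod_pair huv] at h2
    rw [h2, Ex_bit, ← hp]
    simp [huv]
    nlinarith

open Classical in
lemma light_one (y : Fin a → Fin r) (Mx T p s : ℝ) (hT : 0 < T) (hy : Mult y Mx)
    (hp : p = 1 / (q + 1 : ℝ)) :
    Pr (fun ω : Mat r q => s ≤ ∑ w, (if (D1 ω y w : ℝ) ≤ T then (D1 ω y w : ℝ) ^ 2 else 0))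
      ≤ Real.exp (- (s - 2 * r * (p * Mx * a + p ^ 2 * a ^ 2)) / T ^ 2) := by
  have hp0 : 0 ≤ p := by rw [hp]; positivity
  set X : (Fin r → Fin (q + 1)) → ℝ := fun ρ =>
    if ((univ.filter (fun i => ρ (y i) = 0)).card : ℝ) ≤ T
      then ((univ.filter (fun i => ρ (y i) = 0)).card : ℝ) ^ 2 else 0 with hX
  set v := p * Mx * a + p ^ 2 * a ^ 2 with hv
  have hEX : Ex X ≤ v := by
    have h1 : Ex X ≤ Ex (fun ρ : Fin r → Fin (q + 1) => ∑ i : Fin a, ∑ j : Fin a,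
        (if ρ (y i) = 0 then (1:ℝ) else 0) * (if ρ (y j) = 0 then 1 else 0)) := by
      refine Ex_mono (fun ρ => ?_)
      have : ((univ.filter (fun i => ρ (y i) = 0)).card : ℝ) = ∑ i : Fin a,
        (if ρ (y i) = 0 then (1:ℝ) else 0) := by
        rw [Finset.card_filter]; push_cast; rfl
      rw [← Finset.sum_mul_sum, ← this, hX]
      dsimp only
      split_ifs
      · rw [sq]
      · positivity
    refine h1.trans ?_
    rw [Ex_sum]
    have h2 : ∀ i : Fin a, Ex (fun ρ : Fin r → Fin (q + 1) => ∑ j : Fin a,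
        (if ρ (y i) = 0 then (1:ℝ) else 0) * (if ρ (y j) = 0 then 1 else 0))
        ≤ p * Mx + a * p ^ 2 := by
      intro i
      rw [Ex_sum]
      calc _ ≤ ∑ j : Fin a, ((if y j = y i then p else 0) + p ^ 2) := by
            refine Finset.sum_le_sum (fun j _ => ?_)
            refine (pair_bit (y i) (y j) p hp).trans (le_of_eq ?_)
            simp only [eq_comm]
        _ = ((univ.filter (fun j => y j = y i)).card : ℝ) * p + a * p ^ 2 := by
            rw [Finset.sum_add_distrib, ← Finset.sum_filter]
            simp
        _ ≤ _ := by
            have := hy (y i)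
            nlinarith
    calc _ ≤ ∑ _i : Fin a, (p * Mx + a * p ^ 2) := Finset.sum_le_sum (fun i _ => h2 i)
      _ = v := by simp [hv]; ring
  have hX0 : ∀ ρ, 0 ≤ X ρ := fun ρ => by rw [hX]; dsimp only; split_ifs <;> positivity
  have hX1 : ∀ ρ, X ρ ≤ T ^ 2 := fun ρ => by
    rw [hX]; dsimp only
    split_ifs with h
    · gcongr
    · positivity
  have hT2 : 0 < T ^ 2 := by positivity
  have hE : Ex (fun ρ => Real.exp (X ρ / T ^ 2)) ≤ Real.exp (2 * v / T ^ 2) := by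
    calc Ex (fun ρ => Real.exp (X ρ / T ^ 2)) ≤ Ex (fun ρ => 1 + (2 / T ^ 2) * X ρ) := by
          refine Ex_mono (fun ρ => ?_)
          have h0 : 0 ≤ X ρ / T ^ 2 := div_nonneg (hX0 ρ) hT2.le
          have h1 : X ρ / T ^ 2 ≤ 1 := (div_le_one hT2).mpr (hX1 ρ)
          have := exp_bound (z := X ρ / T ^ 2) (by rw [abs_of_nonneg h0]; exact h1)
          have h3 : (2 / T ^ 2) * X ρ = 2 * (X ρ / T ^ 2) := by ring
          nlinarith
      _ = 1 + (2 / T ^ 2) * Ex X := by rw [Ex_add, Ex_const, Ex_mul_left]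
      _ ≤ 1 + (2 / T ^ 2) * v := by gcongr
      _ = 2 * v / T ^ 2 + 1 := by ring
      _ ≤ _ := Real.add_one_le_exp _
  have hprod := Ex_pi_prod (ι := Fin r) (fun (_ : Fin r) ρ => Real.exp (X ρ / T ^ 2))
  have hcur := Ex_equiv (Equiv.curry (Fin r) (Fin r) (Fin (q+1)))
    (fun ω : Fin r → (Fin r → Fin (q+1)) => ∏ w, Real.exp (X (ω w) / T ^ 2))
  rw [hprod] at hcur
  have hle : ∏ _w : Fin r, Ex (fun ρ => Real.exp (X ρ / T ^ 2)) ≤ Real.exp (r * (2 * v / T ^ 2)) := by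
    rw [Finset.prod_const, Finset.card_univ, Fintype.card_fin, Real.exp_nat_mul]
    exact pow_le_pow_left₀ (Ex_nonneg fun _ => by positivity) hE r
  rw [← hcur] at hle
  have h1 := mul_le_mul_of_nonneg_left hle (Real.exp_nonneg (-(s / T ^ 2)))
  rw [← Ex_mul_left, ← Real.exp_add] at h1
  refine le_trans (Pr_le_Ex (fun ω => ?_) (fun ω hω => ?_)) (h1.trans (le_of_eq ?_))
  · exact mul_nonneg (by positivity) (Finset.prod_nonneg fun _ _ => by positivity)
  · rw [← Real.exp_sum, ← Real.exp_add]
    apply Real.one_le_exp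
    rw [← Finset.sum_div]
    have : ∑ w, X (Equiv.curry (Fin r) (Fin r) (Fin (q+1)) ω w)
        = ∑ w, (if (D1 ω y w : ℝ) ≤ T then (D1 ω y w : ℝ) ^ 2 else 0) := rfl
    rw [this]
    rw [neg_add_eq_sub, ← sub_div]
    apply div_nonneg _ hT2.le
    linarith
  · congr 1
    field_simp
    ring

open Classical in
lemma heavy_one (W : Finset (Fin r)) (K S : ℕ) (B p : ℝ) (hB : 1 ≤ B)
    (hp : p = 1 / (q + 1 : ℝ)) (hs : p * B * W.card ≤ 1) (hr : (r : ℝ) ≤ B ^ K) :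
    Pr (fun ω : Mat r q => S ≤ ∑ y, (ew ω W y - K)) ≤ Real.exp 3 / B ^ S := by
  have hp0 : 0 ≤ p := by rw [hp]; positivity
  have hB0 : 0 < B := by linarith
  set X : (Fin r → Fin (q + 1)) → ℕ := fun ρ => (W.filter (fun w => ρ w = 0)).card with hX
  have hE1 : Ex (fun ρ => B ^ (X ρ)) ≤ Real.exp 1 := by
    have h2 := Ex_pi_prod_finset (α := Fin (q+1)) W (fun _ b => if b = 0 then B else 1)
    have h3 : ∀ ρ : Fin r → Fin (q+1), ∏ i ∈ W, (if ρ i = 0 then B else 1) = B ^ (X ρ) := by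
      intro ρ
      rw [← Finset.prod_filter, Finset.prod_const]
    simp only [h3] at h2
    rw [h2, Finset.prod_const, Ex_bit, ← hp]
    calc (1 + p * (B - 1)) ^ W.card ≤ (Real.exp (p * B)) ^ W.card := by
          have h0 : 0 ≤ p * (B - 1) := mul_nonneg hp0 (by linarith)
          apply pow_le_pow_left₀ (by linarith)
          have := Real.add_one_le_exp (p * B)
          nlinarith
      _ = Real.exp (W.card * (p * B)) := by rw [Real.exp_nat_mul]
      _ ≤ _ := Real.exp_le_exp.mpr (by linarith)
  have hE : Ex (fun ρ => B ^ (X ρ - K)) ≤ Real.exp (3 / B ^ K) := by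
    calc Ex (fun ρ => B ^ (X ρ - K)) ≤ Ex (fun ρ => 1 + (1 / B ^ K) * B ^ (X ρ)) := by
          refine Ex_mono (fun ρ => ?_)
          rcases le_total K (X ρ) with h | h
          · have : B ^ (X ρ) = B ^ (X ρ - K) * B ^ K := by rw [← pow_add, Nat.sub_add_cancel h]
            rw [this]
            have hBK : 0 < B ^ K := by positivity
            field_simp
            linarith
          · rw [Nat.sub_eq_zero_of_le h, pow_zero]
            have : 0 ≤ (1 / B ^ K) * B ^ (X ρ) := by positivity
            linarith
      _ = 1 + (1 / B ^ K) * Ex (fun ρ => B ^ (X ρ)) := by rw [Ex_add, Ex_const, Ex_mul_left]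
      _ ≤ 1 + (1 / B ^ K) * 3 := by
          gcongr
          exact hE1.trans (by linarith [Real.exp_one_lt_d9])
      _ = 3 / B ^ K + 1 := by ring
      _ ≤ _ := Real.add_one_le_exp _
  have hprod := Ex_pi_prod (ι := Fin r) (fun (_ : Fin r) ρ => B ^ (X ρ - K))
  have hcur := Ex_equiv (((Equiv.prodComm (Fin r) (Fin r)).arrowCongr (Equiv.refl (Fin (q+1)))).trans
    (Equiv.curry (Fin r) (Fin r) (Fin (q+1))))
    (fun ω : Fin r → (Fin r → Fin (q+1)) => ∏ y, B ^ (X (ω y) - K))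
  rw [hprod] at hcur
  have hle : ∏ _w : Fin r, Ex (fun ρ => B ^ (X ρ - K)) ≤ Real.exp 3 := by
    rw [Finset.prod_const, Finset.card_univ, Fintype.card_fin]
    calc _ ≤ (Real.exp (3 / B ^ K)) ^ r :=
          pow_le_pow_left₀ (Ex_nonneg fun _ => by positivity) hE r
      _ = Real.exp (r * (3 / B ^ K)) := by rw [Real.exp_nat_mul]
      _ ≤ _ := by
          apply Real.exp_le_exp.mpr
          have hBK : 0 < B ^ K := by positivity
          rw [mul_div_assoc', div_le_iff₀ hBK]
          linarith
  rw [← hcur] at hle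
  have h1 := mul_le_mul_of_nonneg_left hle (by positivity : 0 ≤ 1 / B ^ S)
  rw [← Ex_mul_left] at h1
  refine le_trans (Pr_le_Ex (fun ω => ?_) (fun ω hω => ?_)) (h1.trans (le_of_eq (by ring)))
  · exact mul_nonneg (by positivity) (Finset.prod_nonneg fun _ _ => by positivity)
  · rw [Finset.prod_pow_eq_pow_sum]
    have hBS : 0 < B ^ S := by positivity
    rw [one_div, ← div_eq_inv_mul, le_div_iff₀ hBS, one_mul]
    exact pow_le_pow_right₀ hB hω

end TwoBites
end


noncomputable section

namespace TwoBites

open Finset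

/-- The choice of parameters. -/
structure Par (n r q a s0 : ℕ) (h g p : ℝ) : Prop where
  hp : p = 1 / (q + 1 : ℝ)
  hn : (n : ℝ) = h ^ 100
  hg : (n : ℝ) = Real.exp (g ^ 2)
  g1 : 1 ≤ g
  gh : 10 ^ 20 * g ^ 4 ≤ h
  r1 : h ^ 96 / 2 ≤ r
  r2 : (r : ℝ) ≤ h ^ 96
  p1 : g ≤ p * h ^ 50
  p2 : p * h ^ 50 ≤ 2 * g
  a1 : 10 ^ 6 * g * h ^ 50 ≤ a
  a2 : (a : ℝ) ≤ 2 * 10 ^ 6 * g * h ^ 50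
  s1 : h ^ 45 / 2 ≤ s0
  s2 : (s0 : ℝ) ≤ h ^ 45

namespace Par
variable {n r q a s0 : ℕ} {h g p : ℝ} (P : Par n r q a s0 h g p)
include P

end Par

open Classical in
/-- Number of elements with a given property. -/
def cnt {ι : Type*} [Fintype ι] (s : ι → Prop) : ℕ := (univ.filter s).card

lemma cnt_eq {ι : Type*} [Fintype ι] (s : ι → Prop) [DecidablePred s] :
    cnt s = (univ.filter s).card := by
  unfold cnt; congr!

lemma cnt_mono {ι : Type*} [Fintype ι] {s t : ι → Prop} (h : ∀ i, s i → t i) :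
    cnt s ≤ cnt t := by
  classical
  rw [cnt_eq, cnt_eq]
  exact card_le_card (fun i hi => by simp only [mem_filter, mem_univ, true_and] at hi ⊢; exact h i hi)

lemma cnt_congr {ι : Type*} [Fintype ι] {s t : ι → Prop} (h : ∀ i, s i ↔ t i) :
    cnt s = cnt t := le_antisymm (cnt_mono fun i => (h i).mp) (cnt_mono fun i => (h i).mpr)

open Classical in
lemma count_tail {n : ℕ} {α : Type*} [Fintype α] [Nonempty α] (Z : Finset α) (H c : ℝ)
    (hH : 1 ≤ H) (hc : (Z.card : ℝ) ≤ c * Fintype.card α) (k : ℕ) :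
    Pr (fun ω : Fin n → α => k ≤ cnt (fun v => ω v ∈ Z))
      ≤ Real.exp (n * c * H) / H ^ k := by
  have hH0 : 0 < H := by linarith
  have hα : (0:ℝ) < Fintype.card α := by exact_mod_cast Fintype.card_pos
  have hc0 : 0 ≤ c := by
    by_contra hcon
    push Not at hcon
    have : c * Fintype.card α < 0 := mul_neg_of_neg_of_pos hcon hα
    have h0 : (0:ℝ) ≤ Z.card := by positivity
    linarith
  have hE := Ex_pi_prod (ι := Fin n) (fun (_ : Fin n) (x : α) => if x ∈ Z then H else 1)
  have h1 : Ex (fun x : α => if x ∈ Z then H else 1) ≤ Real.exp (c * H) := by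
    have : Ex (fun x : α => if x ∈ Z then H else 1) ≤ 1 + c * H := by
      unfold Ex
      rw [div_le_iff₀ hα]
      have : ∀ x : α, (if x ∈ Z then H else 1) ≤ 1 + (if x ∈ Z then H else 0) := by
        intro x; split_ifs <;> linarith
      calc _ ≤ ∑ x : α, (1 + (if x ∈ Z then H else 0)) := Finset.sum_le_sum fun x _ => this x
        _ = Fintype.card α + Z.card * H := by
            rw [Finset.sum_add_distrib]; simp
        _ ≤ _ := by nlinarith
    have h2 := Real.add_one_le_exp (c * H)
    linarith
  have h0 : 0 ≤ Ex (fun x : α => if x ∈ Z then H else 1) :=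
    Ex_nonneg fun x => by split_ifs <;> linarith
  have h2 : ∏ _i : Fin n, Ex (fun x : α => if x ∈ Z then H else 1) ≤ Real.exp (n * c * H) := by
    rw [Finset.prod_const, Finset.card_univ, Fintype.card_fin, mul_assoc, Real.exp_nat_mul]
    exact pow_le_pow_left₀ h0 h1 n
  rw [← hE] at h2
  have h3 := mul_le_mul_of_nonneg_left h2 (by positivity : 0 ≤ 1 / H ^ k)
  rw [← Ex_mul_left] at h3
  refine le_trans (Pr_le_Ex (fun ω => ?_) (fun ω hω => ?_)) (h3.trans (le_of_eq (by ring)))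
  · exact mul_nonneg (by positivity)
      (Finset.prod_nonneg fun _ _ => by split_ifs <;> linarith)
  · have : (∏ i, if ω i ∈ Z then H else 1) = H ^ cnt (fun v => ω v ∈ Z) := by
      rw [cnt_eq, ← Finset.prod_filter, Finset.prod_const]
    rw [this]
    have hBS : 0 < H ^ k := by positivity
    rw [one_div, ← div_eq_inv_mul, le_div_iff₀ hBS, one_mul]
    exact pow_le_pow_right₀ hH hω

lemma enum_finset {α : Type*} [Nonempty α] (s : Finset α) (a : ℕ) (hs : s.card ≤ a) :
    ∃ f : Fin a → α, ∀ x ∈ s, ∃ i, f i = x := by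
  classical
  refine ⟨fun i => if hi : (i : ℕ) < s.card then (s.equivFin.symm ⟨i, hi⟩ : α)
    else Classical.arbitrary α, fun x hx => ?_⟩
  refine ⟨⟨(s.equivFin ⟨x, hx⟩ : ℕ), lt_of_lt_of_le (s.equivFin ⟨x, hx⟩).2 hs⟩, ?_⟩
  simp

/-- Fibre bound for a vertex map. -/
def Fib {n r : ℕ} (ρ : Fin n → Fin r) (M : ℝ) : Prop :=
  ∀ x, (cnt (fun v => ρ v = x) : ℝ) ≤ M

namespace Par
variable {n r q a s0 : ℕ} {h g p : ℝ} (P : Par n r q a s0 h g p)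
include P

lemma h1 : 10 ^ 20 ≤ h := by
  have := P.gh
  have : 1 ≤ g ^ 4 := one_le_pow₀ P.g1
  linarith

lemma h0 : 0 < h := by have := P.h1; linarith

lemma g0 : 0 < g := by have := P.g1; linarith

lemma p0 : 0 ≤ p := by rw [P.hp]; positivity

lemma gg : 10 ^ 20 * g ≤ h := by
  have h2 : g ^ 1 ≤ g ^ 4 := pow_le_pow_right₀ P.g1 (by norm_num)
  have := P.gh
  linarith

lemma gg2 : 10 ^ 20 * g ^ 2 ≤ h := by
  have h2 : g ^ 2 ≤ g ^ 4 := pow_le_pow_right₀ P.g1 (by norm_num)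
  have := P.gh
  linarith

lemma hk (k : ℕ) : 1 ≤ h ^ k := one_le_pow₀ (by have := P.h1; linarith)

lemma rpos : 0 < r := by
  have := P.r1
  have h2 := P.hk 96
  have : (0:ℝ) < r := by linarith
  exact_mod_cast this

lemma apos : 0 < a := by
  have := P.a1
  have h2 := P.hk 50
  have : 1 ≤ g * h ^ 50 := by nlinarith [P.g1]
  have : (0:ℝ) < a := by nlinarith
  exact_mod_cast this

lemma rn : (r : ℝ) ≤ Real.exp (g ^ 2) := by
  rw [← P.hg, P.hn]
  refine P.r2.trans (pow_le_pow_right₀ (by have := P.h1; linarith) (by norm_num))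

/-- `n / r ≤ 2 h ^ 4`. -/
lemma nr : (n : ℝ) ≤ 2 * h ^ 4 * r := by
  rw [P.hn]
  have h1 := P.r1
  have h2 : 0 ≤ 2 * h ^ 4 := by have := P.hk 4; linarith
  have := mul_le_mul_of_nonneg_left h1 h2
  calc h ^ 100 = 2 * h ^ 4 * (h ^ 96 / 2) := by ring
    _ ≤ _ := this

open Classical in
lemma fib_tail (Z : Finset (Fin r × Fin r)) (hZ : Z.card = r) :
    Pr (fun ω : Fin n → Fin r × Fin r =>
      20 * h ^ 4 < (cnt (fun v => ω v ∈ Z) : ℝ)) ≤ Real.exp (- h) := by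
  have : Nonempty (Fin r) := ⟨⟨0, P.rpos⟩⟩
  have hr : (0:ℝ) < r := by exact_mod_cast P.rpos
  have h1 := count_tail (n := n) Z (Real.exp 1) (1 / r) (Real.one_le_exp (by norm_num))
    (by rw [hZ]; simp; field_simp; exact le_refl _) ⌈20 * h ^ 4⌉₊
  refine le_trans (Pr_mono (fun ω hω => ?_)) (h1.trans ?_)
  · exact Nat.ceil_le.mpr hω.le
  · rw [← Real.exp_nat_mul, ← Real.exp_sub]
    apply Real.exp_le_exp.mpr
    have h2 := P.nr
    have h3 : (n:ℝ) * (1 / r) ≤ 2 * h ^ 4 := by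
      rw [mul_one_div, div_le_iff₀ hr]; exact h2
    have h4 := Nat.le_ceil (20 * h ^ 4)
    have h5 := Real.exp_one_lt_d9
    have h6 : h ≤ h ^ 4 := le_self_pow₀ (by have := P.h1; linarith) (by norm_num)
    have h7 : 0 ≤ (n:ℝ) * (1 / r) := by positivity
    have h8 : (n:ℝ) * (1 / r) * Real.exp 1 ≤ 2 * h ^ 4 * 3 := by
      apply mul_le_mul h3 (by linarith) (Real.exp_nonneg _)
      linarith
    have := P.h0
    linarith

open Classical in
lemma pair_tail (Z : Finset (Fin r × Fin r)) (hZ : Z.card ≤ a * a) :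
    Pr (fun ω : Fin n → Fin r × Fin r =>
      10 * a ≤ cnt (fun v => ω v ∈ Z)) ≤ Real.exp (a - 4 * g ^ 2 * a) := by
  have : Nonempty (Fin r) := ⟨⟨0, P.rpos⟩⟩
  have hr : (0:ℝ) < r := by exact_mod_cast P.rpos
  have h1 := count_tail (n := n) Z (h ^ 40) ((a * a : ℝ) / (r * r)) (P.hk 40)
    (by simp; field_simp; rw [sq]; exact_mod_cast hZ) (10 * a)
  refine h1.trans ?_
  have h2 : (h ^ 40) ^ (10 * a) = Real.exp (4 * g ^ 2 * a) := by
    have : Real.exp (4 * g ^ 2 * a) = (Real.exp (g ^ 2)) ^ (4 * a) := by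
      rw [← Real.exp_nat_mul]; push_cast; ring_nf
    rw [this, ← P.hg, P.hn, ← pow_mul, ← pow_mul]
    ring_nf
  rw [h2, ← Real.exp_sub]
  apply Real.exp_le_exp.mpr
  have hp := P.h0
  have hg0 := P.g0
  have ha : (0:ℝ) ≤ a := by positivity
  suffices h3 : (n:ℝ) * ((a * a : ℝ) / (r * r)) * h ^ 40 ≤ a by linarith
  rw [mul_div_assoc', div_mul_eq_mul_div, div_le_iff₀ (by positivity)]
  have h4 : h ^ 96 / 2 * (h ^ 96 / 2) ≤ (r:ℝ) * r := by
    apply mul_self_le_mul_self (by positivity) P.r1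
  have h5 : (n:ℝ) * a * h ^ 40 ≤ r * r := by
    refine le_trans ?_ h4
    rw [P.hn]
    calc h ^ 100 * a * h ^ 40 ≤ h ^ 100 * (2 * 10 ^ 6 * g * h ^ 50) * h ^ 40 := by
          gcongr; exact P.a2
      _ = 8 * 10 ^ 6 * g * (h ^ 190 / 4) := by ring
      _ ≤ h ^ 2 * (h ^ 190 / 4) := by
          gcongr
          nlinarith [P.gg, P.h1]
      _ = _ := by ring
  calc (n:ℝ) * (a * a) * h ^ 40 = a * (n * a * h ^ 40) := by ring
    _ ≤ _ := by gcongr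

open Classical in
lemma maps_exist : ∃ ρ β : Fin n → Fin r, Fib ρ (20 * h ^ 4) ∧ Fib β (20 * h ^ 4) ∧
    ∀ I : Finset (Fin n), 10 * a ≤ I.card → a ≤ (I.image ρ).card ∨ a ≤ (I.image β).card := by
  have : Nonempty (Fin r) := ⟨⟨0, P.rpos⟩⟩
  have hh := P.h1
  have e1 : Real.exp (g ^ 2 - h) ≤ 1 / 4 := by
    have : g ^ 2 - h ≤ -3 := by nlinarith [P.gg2, P.h1]
    refine (Real.exp_le_exp.mpr this).trans ?_
    rw [Real.exp_neg, inv_le_comm₀ (Real.exp_pos _) (by norm_num)]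
    have := Real.add_one_le_exp (3:ℝ)
    linarith
  have b1 : ∀ Z : Fin r → Finset (Fin r × Fin r), (∀ x, (Z x).card = r) →
      Pr (fun ω : Fin n → Fin r × Fin r => ∃ x,
        20 * h ^ 4 < (cnt (fun v => ω v ∈ Z x) : ℝ)) ≤ 1 / 4 := by
    intro Z hZ
    refine (Pr_exists _ (fun x => P.fib_tail (Z x) (hZ x))).trans ?_
    refine le_trans ?_ e1
    rw [Fintype.card_fin, sub_eq_add_neg, Real.exp_add]
    gcongr
    exact P.rn
  have b2 := b1 (fun x => {x} ×ˢ univ) (by intro x; simp)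
  have b3 := b1 (fun x => univ ×ˢ {x}) (by intro x; simp)
  have b4 : Pr (fun ω : Fin n → Fin r × Fin r => ∃ f : (Fin a → Fin r) × (Fin a → Fin r),
      10 * a ≤ cnt (fun v => ω v ∈ (univ.image f.1) ×ˢ (univ.image f.2))) ≤ 1 / 4 := by
    refine (Pr_exists _ (fun f => P.pair_tail _ ?_)).trans ?_
    · rw [Finset.card_product]
      exact Nat.mul_le_mul (card_image_le.trans (by simp)) (card_image_le.trans (by simp))
    · have ha : (1:ℝ) ≤ a := by exact_mod_cast P.apos
      have h2 : ((Fintype.card ((Fin a → Fin r) × (Fin a → Fin r)) : ℕ) : ℝ)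
          ≤ Real.exp (2 * g ^ 2 * a) := by
        simp only [Fintype.card_prod, Fintype.card_pi, Fintype.card_fin, Finset.prod_const,
          Finset.card_univ]
        push_cast
        have : Real.exp (2 * g ^ 2 * a) = Real.exp (g ^ 2) ^ a * Real.exp (g ^ 2) ^ a := by
          rw [← Real.exp_nat_mul, ← Real.exp_add]; ring_nf
        rw [this]
        gcongr <;> exact P.rn
      calc _ ≤ Real.exp (2 * g ^ 2 * a) * Real.exp (a - 4 * g ^ 2 * a) := by gcongr
        _ = Real.exp (a - 2 * g ^ 2 * a) := by rw [← Real.exp_add]; ring_nf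
        _ ≤ Real.exp (g ^ 2 - h) := by
            apply Real.exp_le_exp.mpr
            have h3 : (a:ℝ) * 1 ≤ a * g ^ 2 := by
              gcongr; exact one_le_pow₀ P.g1
            have h4 := P.a1
            have h5 : h ≤ h ^ 50 := le_self_pow₀ (by linarith) (by norm_num)
            have h6 : 1 * h ^ 50 ≤ g * h ^ 50 := by gcongr; exact P.g1
            have h7 : 0 ≤ g ^ 2 := by positivity
            nlinarith
        _ ≤ _ := e1
  have b5 := (Pr_or _ _).trans (add_le_add ((Pr_or _ _).trans (add_le_add b2 b3)) b4)
  obtain ⟨ω, hω⟩ := exists_of_Pr_lt_one (lt_of_le_of_lt b5 (by norm_num))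
  push Not at hω
  obtain ⟨⟨c1, c2⟩, c3⟩ := hω
  refine ⟨fun v => (ω v).1, fun v => (ω v).2, fun x => ?_, fun x => ?_, fun I hI => ?_⟩
  · refine le_trans (le_of_eq ?_) (c1 x)
    congr 1
    refine cnt_congr (fun v => ?_)
    simp only [mem_product, mem_univ, mem_singleton, true_and, and_true]
  · refine le_trans (le_of_eq ?_) (c2 x)
    congr 1
    refine cnt_congr (fun v => ?_)
    simp only [mem_product, mem_univ, mem_singleton, true_and, and_true]
  · by_contra hcon
    push Not at hcon
    obtain ⟨f1, hf1⟩ := enum_finset (I.image fun v => (ω v).1) a hcon.1.le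
    obtain ⟨f2, hf2⟩ := enum_finset (I.image fun v => (ω v).2) a hcon.2.le
    refine absurd (c3 (f1, f2)) (not_lt.mpr (hI.trans ?_))
    rw [cnt]
    refine card_le_card ?_
    intro v hv
    simp only [mem_filter, mem_univ, true_and, mem_product, mem_image]
    exact ⟨hf1 _ (mem_image_of_mem _ hv), hf2 _ (mem_image_of_mem _ hv)⟩

end Par

end TwoBites
end


noncomputable section

namespace TwoBites

open Finset

variable {n r q a s0 : ℕ} {h g p : ℝ}

/-- Transposed matrix. -/
def tr (ω : Mat r q) : Mat r q := fun e => ω (e.2, e.1)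

lemma Pr_tr (s : Mat r q → Prop) : Pr (fun ω => s (tr ω)) = Pr s :=
  Pr_equiv ((Equiv.prodComm (Fin r) (Fin r)).arrowCongr (Equiv.refl (Fin (q+1)))) s

lemma D1_eq (ω : Mat r q) (y : Fin a → Fin r) (w : Fin r) :
    D1 ω y w = cnt (fun i => ω (w, y i) = 0) := by
  unfold D1; rw [cnt_eq]

lemma Mult_iff (y : Fin a → Fin r) (M : ℝ) :
    Mult y M ↔ ∀ z, (cnt (fun i => y i = z) : ℝ) ≤ M := by
  unfold Mult; simp only [cnt_eq]

structure Good1 (a s0 : ℕ) (h g : ℝ) (ω : Mat r q) : Prop where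
  light : ∀ y : Fin a → Fin r, Mult y (20 * h ^ 4) →
    ∑ w, (if (D1 ω y w : ℝ) ≤ h ^ 6 then (D1 ω y w : ℝ) ^ 2 else 0) < (a:ℝ) ^ 2 / 128
  heavy : ∀ f : Fin s0 → Fin r, ∑ y, (ew ω (univ.image f) y - 96) < 200 * s0
  row : ∀ w, (cnt (fun y => ω (w, y) = 0) : ℝ) < 3 * g * h ^ 46

lemma cnt_real {ι : Type*} [Fintype ι] (s : ι → Prop) [DecidablePred s] :
    (cnt s : ℝ) = ∑ i, if s i then (1:ℝ) else 0 := by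
  rw [cnt_eq, Finset.card_filter]; push_cast; rfl

namespace Par
variable (P : Par n r q a s0 h g p)
include P

lemma pr : p * r ≤ 2 * g * h ^ 46 := by
  have h2 := P.r2
  have h3 := P.p2
  have := P.h0
  have := P.p0
  calc p * r ≤ p * h ^ 96 := by gcongr
    _ = p * h ^ 50 * h ^ 46 := by ring
    _ ≤ _ := by gcongr

lemma row_tail (w : Fin r) :
    Pr (fun ω : Mat r q => 3 * g * h ^ 46 ≤ (cnt (fun y => ω (w, y) = 0) : ℝ))
      ≤ Real.exp (- h ^ 2) := by
  have h1 := tail_upper (q := q) (univ : Finset (Fin r)) (fun y => (w, y))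
    (by intro x _ y _ hxy; simpa using hxy) (fun _ => 1) 1 (1/4) p (g * h ^ 46) P.hp
    (by intros; norm_num) (by intros; norm_num) (by norm_num) (by norm_num)
  have h2 := P.pr
  have h3 : h ^ 2 ≤ g * h ^ 46 / 8 := by
    have e1 : 8 * h ^ 2 ≤ h ^ 46 := by
      have := P.hk 43
      have := P.h1
      have : h ^ 46 = h ^ 43 * h * h ^ 2 := by ring
      rw [this]
      have := P.hk 2
      gcongr
      nlinarith
    have := P.g1
    have := P.hk 46
    nlinarith
  refine le_trans (Pr_mono (fun ω hω => ?_)) (h1.trans (Real.exp_le_exp.mpr ?_))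
  · rw [cnt_real] at hω
    simp only [Finset.sum_const, Finset.card_univ, Fintype.card_fin, nsmul_eq_mul, mul_one]
    linarith
  · simp only [Finset.sum_const, Finset.card_univ, Fintype.card_fin, nsmul_eq_mul, mul_one]
    nlinarith

lemma light_tail (y : Fin a → Fin r) (hy : Mult y (20 * h ^ 4)) :
    Pr (fun ω : Mat r q => (a:ℝ) ^ 2 / 128 ≤
      ∑ w, (if (D1 ω y w : ℝ) ≤ h ^ 6 then (D1 ω y w : ℝ) ^ 2 else 0))
      ≤ Real.exp (- g ^ 2 * a - h) := by
  have h0 := P.h0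
  have hh1 := P.h1
  have hg1 := P.g1
  have hp0 := P.p0
  have ha1 : (1:ℝ) ≤ a := by exact_mod_cast P.apos
  have h1 := light_one y (20 * h ^ 4) (h ^ 6) p ((a:ℝ) ^ 2 / 128) (by positivity) hy P.hp
  refine h1.trans (Real.exp_le_exp.mpr ?_)
  have hpr := P.pr
  have e1 : 2 * r * (p * (20 * h ^ 4) * a) ≤ (a:ℝ) ^ 2 / 10000 := by
    calc 2 * r * (p * (20 * h ^ 4) * a) = 40 * h ^ 4 * a * (p * r) := by ring
      _ ≤ 40 * h ^ 4 * a * (2 * g * h ^ 46) := by gcongr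
      _ = 80 / 10 ^ 6 * (10 ^ 6 * g * h ^ 50) * a := by ring
      _ ≤ 80 / 10 ^ 6 * a * a := by gcongr; exact P.a1
      _ ≤ _ := by nlinarith
  have e2 : 2 * r * (p ^ 2 * (a:ℝ) ^ 2) ≤ (a:ℝ) ^ 2 / 10000 := by
    have : 2 * r * p ^ 2 ≤ 1 / 10000 := by
      have e3 : 2 * r * p ^ 2 * h ^ 4 ≤ 8 * g ^ 2 := by
        calc 2 * r * p ^ 2 * h ^ 4 ≤ 2 * h ^ 96 * p ^ 2 * h ^ 4 := by gcongr; exact P.r2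
          _ = 2 * (p * h ^ 50) ^ 2 := by ring
          _ ≤ 2 * (2 * g) ^ 2 := by
              have := pow_le_pow_left₀ (by positivity) P.p2 2
              linarith
          _ = _ := by ring
      have e4 : 80000 * g ^ 2 ≤ h ^ 4 := by
        have := P.gg2
        have : h ≤ h ^ 4 := le_self_pow₀ (by linarith) (by norm_num)
        nlinarith
      have h4 : 0 < h ^ 4 := by positivity
      rw [← mul_le_mul_iff_left₀ h4]
      linarith
    nlinarith [sq_nonneg (a:ℝ)]
  have e3 : (a:ℝ) ^ 2 / 256 ≤ (a:ℝ) ^ 2 / 128 - 2 * r * (p * (20 * h ^ 4) * a + p ^ 2 * a ^ 2) := by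
    have : 0 ≤ (a:ℝ) ^ 2 := by positivity
    linarith
  have e4 : g ^ 2 * a + h ≤ (a:ℝ) ^ 2 / 256 / (h ^ 6) ^ 2 := by
    rw [div_div, le_div_iff₀ (by positivity)]
    have e5 : (g ^ 2 + h) * (256 * (h ^ 6) ^ 2) ≤ a := by
      refine le_trans ?_ P.a1
      have e6 : g ^ 2 + h ≤ 2 * h := by nlinarith [P.gg2, sq_nonneg g]
      calc (g ^ 2 + h) * (256 * (h ^ 6) ^ 2) ≤ (2 * h) * (256 * (h ^ 6) ^ 2) := by gcongr
        _ = 512 * 1 * h ^ 13 := by ring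
        _ ≤ 10 ^ 6 * g * h ^ 50 := by
            have : h ^ 13 ≤ h ^ 50 := pow_le_pow_right₀ (by linarith) (by norm_num)
            gcongr
            norm_num
    calc (g ^ 2 * a + h) * (256 * (h ^ 6) ^ 2) ≤ ((g ^ 2 + h) * (256 * (h ^ 6) ^ 2)) * (a:ℝ) := by
          have : h ≤ h * a := by nlinarith
          have : (0:ℝ) ≤ 256 * (h ^ 6) ^ 2 := by positivity
          nlinarith
      _ ≤ (a:ℝ) * a := by gcongr
      _ = (a:ℝ) ^ 2 := by ring
  have e5 : (a:ℝ) ^ 2 / 256 / (h ^ 6) ^ 2 ≤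
      ((a:ℝ) ^ 2 / 128 - 2 * r * (p * (20 * h ^ 4) * a + p ^ 2 * a ^ 2)) / (h ^ 6) ^ 2 := by
    gcongr
  rw [neg_div]
  linarith

lemma heavy_tail (f : Fin s0 → Fin r) :
    Pr (fun ω : Mat r q => 200 * s0 ≤ ∑ y, (ew ω (univ.image f) y - 96))
      ≤ Real.exp (- g ^ 2 * s0 - h) := by
  have h0 := P.h0
  have hh1 := P.h1
  have hg1 := P.g1
  have hp0 := P.p0
  have hc : ((univ.image f).card : ℝ) ≤ s0 := by
    have : (univ.image f).card ≤ s0 := card_image_le.trans (by simp)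
    exact_mod_cast this
  have h1 := heavy_one (q := q) (univ.image f) 96 (200 * s0) h p (by linarith) P.hp (by
    calc p * h * ((univ.image f).card : ℝ) ≤ p * h * h ^ 45 := by
          gcongr; exact hc.trans P.s2
      _ ≤ 1 := by
          have h4 : 0 < h ^ 4 := by positivity
          rw [← mul_le_mul_iff_left₀ h4]
          calc p * h * h ^ 45 * h ^ 4 = p * h ^ 50 := by ring
            _ ≤ 2 * g := P.p2
            _ ≤ h := by linarith [P.gg]
            _ ≤ 1 * h ^ 4 := by
              rw [one_mul]; exact le_self_pow₀ (by linarith) (by norm_num)) P.r2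
  refine h1.trans ?_
  have h2 : h ^ (200 * s0) = Real.exp (2 * g ^ 2 * s0) := by
    have : Real.exp (2 * g ^ 2 * s0) = (Real.exp (g ^ 2)) ^ (2 * s0) := by
      rw [← Real.exp_nat_mul]; push_cast; ring_nf
    rw [this, ← P.hg, P.hn, ← pow_mul]
    ring_nf
  rw [h2, ← Real.exp_sub]
  apply Real.exp_le_exp.mpr
  have h3 : 3 + h ≤ s0 := by
    refine le_trans ?_ P.s1
    have : h ^ 2 ≤ h ^ 45 := pow_le_pow_right₀ (by linarith) (by norm_num)
    nlinarith
  have : (1:ℝ) * s0 ≤ g ^ 2 * s0 := by gcongr; exact one_le_pow₀ hg1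
  linarith

lemma rpow (k : ℕ) : ((Fintype.card (Fin k → Fin r) : ℕ) : ℝ) ≤ Real.exp (g ^ 2 * k) := by
  simp only [Fintype.card_pi, Fintype.card_fin, Finset.prod_const, Finset.card_univ]
  push_cast
  rw [mul_comm, Real.exp_nat_mul]
  gcongr
  exact P.rn

lemma good1_tail : Pr (fun ω : Mat r q => ¬ Good1 a s0 h g ω) ≤ 3 * Real.exp (- h) := by
  have b1 : Pr (fun ω : Mat r q => ∃ w, 3 * g * h ^ 46 ≤ (cnt (fun y => ω (w, y) = 0) : ℝ))
      ≤ Real.exp (- h) := by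
    refine (Pr_exists _ P.row_tail).trans ?_
    rw [Fintype.card_fin]
    calc (r:ℝ) * Real.exp (- h ^ 2) ≤ Real.exp (g ^ 2) * Real.exp (- h ^ 2) := by
          gcongr; exact P.rn
      _ = Real.exp (g ^ 2 - h ^ 2) := by rw [← Real.exp_add]; ring_nf
      _ ≤ _ := by
        apply Real.exp_le_exp.mpr
        nlinarith [P.gg2, P.h1, P.g1]
  have b2 : Pr (fun ω : Mat r q => ∃ y : Fin a → Fin r, Mult y (20 * h ^ 4) ∧ (a:ℝ) ^ 2 / 128 ≤
      ∑ w, (if (D1 ω y w : ℝ) ≤ h ^ 6 then (D1 ω y w : ℝ) ^ 2 else 0)) ≤ Real.exp (- h) := by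
    refine (Pr_exists (b := Real.exp (- g ^ 2 * a - h)) _ (fun y => ?_)).trans ?_
    · by_cases hy : Mult y (20 * h ^ 4)
      · exact le_trans (Pr_mono fun ω hω => hω.2) (P.light_tail y hy)
      · refine le_trans (Pr_le_Ex (f := fun _ => 0) (fun _ => le_refl _) ?_) ?_
        · intro ω hω; exact absurd hω.1 hy
        · unfold Ex; simp; positivity
    · calc _ ≤ Real.exp (g ^ 2 * a) * Real.exp (- g ^ 2 * a - h) := by gcongr; exact P.rpow a
        _ = _ := by rw [← Real.exp_add]; ring_nf
  have b3 : Pr (fun ω : Mat r q => ∃ f : Fin s0 → Fin r,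
      200 * s0 ≤ ∑ y, (ew ω (univ.image f) y - 96)) ≤ Real.exp (- h) := by
    refine (Pr_exists _ (fun f => P.heavy_tail f)).trans ?_
    calc _ ≤ Real.exp (g ^ 2 * s0) * Real.exp (- g ^ 2 * s0 - h) := by gcongr; exact P.rpow s0
      _ = _ := by rw [← Real.exp_add]; ring_nf
  have b4 := (Pr_or _ _).trans (add_le_add ((Pr_or _ _).trans (add_le_add b1 b2)) b3)
  refine le_trans (Pr_mono fun ω hω => ?_) (b4.trans (le_of_eq (by ring)))
  by_contra hc
  push Not at hc
  exact hω ⟨hc.1.2, hc.2, hc.1.1⟩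

end Par

lemma ew_mono (ω : Mat r q) {W W' : Finset (Fin r)} (hW : W ⊆ W') (y : Fin r) :
    ew ω W y ≤ ew ω W' y := by
  unfold ew
  exact card_le_card (filter_subset_filter _ hW)

lemma D1_sum (ω : Mat r q) (y : Fin a → Fin r) (W : Finset (Fin r)) :
    ∑ w ∈ W, D1 ω y w = ∑ i, ew ω W (y i) := by
  classical
  unfold D1 ew
  simp only [Finset.card_filter]
  rw [Finset.sum_comm]

lemma fib_sum (y : Fin a → Fin r) (M : ℝ) (hy : Mult y M) (f : Fin r → ℕ) :
    ∑ i, (f (y i) : ℝ) ≤ M * ∑ z, (f z : ℝ) := by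
  classical
  rw [← Finset.sum_fiberwise (s := univ) (g := y) (f := fun i => (f (y i) : ℝ)), Finset.mul_sum]
  refine Finset.sum_le_sum fun z _ => ?_
  have : ∑ i ∈ univ.filter (fun i => y i = z), (f (y i) : ℝ)
      = ((univ.filter (fun i => y i = z)).card : ℝ) * f z := by
    rw [Finset.sum_congr rfl (g := fun _ => (f z : ℝ)) (fun i hi => by
      simp only [mem_filter] at hi; rw [hi.2])]
    simp
  rw [this]
  have h1 := (Mult_iff y M).mp hy z
  rw [cnt_eq] at h1
  gcongr

namespace Par
variable (P : Par n r q a s0 h g p)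
include P

lemma heavy_sum {ω : Mat r q} (hG : Good1 a s0 h g ω) (y : Fin a → Fin r)
    (hy : Mult y (20 * h ^ 4)) (W : Finset (Fin r)) (hW : W.card ≤ s0) :
    ∑ w ∈ W, (D1 ω y w : ℝ) ≤ 97 * a := by
  have h0 := P.h0
  have hh1 := P.h1
  have hg1 := P.g1
  have : Nonempty (Fin r) := ⟨⟨0, P.rpos⟩⟩
  obtain ⟨f, hf⟩ := enum_finset W s0 hW
  have hsub : W ⊆ univ.image f := by
    intro w hw
    obtain ⟨i, hi⟩ := hf w hw
    exact mem_image.mpr ⟨i, mem_univ _, hi⟩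
  have h1 := hG.heavy f
  have h2 : ∑ w ∈ W, (D1 ω y w : ℝ) = ∑ i, (ew ω W (y i) : ℝ) := by
    have := D1_sum ω y W
    exact_mod_cast this
  rw [h2]
  have h3 : ∀ i, (ew ω W (y i) : ℝ) ≤ 96 + ((ew ω (univ.image f) (y i) - 96 : ℕ) : ℝ) := by
    intro i
    have := ew_mono ω hsub (y i)
    have : ew ω W (y i) ≤ 96 + (ew ω (univ.image f) (y i) - 96) := by omega
    exact_mod_cast this
  have h4 := fib_sum y _ hy (fun z => ew ω (univ.image f) z - 96)
  have h5 : ∑ z, ((ew ω (univ.image f) z - 96 : ℕ) : ℝ) ≤ 200 * s0 := by exact_mod_cast h1.le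
  calc ∑ i, (ew ω W (y i) : ℝ) ≤ ∑ i, (96 + ((ew ω (univ.image f) (y i) - 96 : ℕ) : ℝ)) :=
        Finset.sum_le_sum fun i _ => h3 i
    _ = 96 * a + ∑ i, ((ew ω (univ.image f) (y i) - 96 : ℕ) : ℝ) := by
        rw [Finset.sum_add_distrib]; simp; ring
    _ ≤ 96 * a + 20 * h ^ 4 * (200 * s0) := by
        have : 20 * h ^ 4 * ∑ z, ((ew ω (univ.image f) z - 96 : ℕ) : ℝ)
          ≤ 20 * h ^ 4 * (200 * s0) := by gcongr
        linarith
    _ ≤ 96 * a + 20 * h ^ 4 * (200 * h ^ 45) := by gcongr; exact P.s2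
    _ = 96 * a + 4000 * h ^ 49 := by ring
    _ ≤ 96 * a + a := by
        have : 4000 * h ^ 49 ≤ a := by
          refine le_trans ?_ P.a1
          have : h ^ 50 = h * h ^ 49 := by ring
          rw [this]
          have := P.hk 49
          have e : 4000 ≤ 10 ^ 6 * g * h := by nlinarith
          calc 4000 * h ^ 49 ≤ 10 ^ 6 * g * h * h ^ 49 := by gcongr
            _ = _ := by ring
        linarith
    _ = _ := by ring

lemma D1_le {ω : Mat r q} (hG : Good1 a s0 h g ω) (y : Fin a → Fin r)
    (hy : Mult y (20 * h ^ 4)) (w : Fin r) : (D1 ω y w : ℝ) ≤ 60 * g * h ^ 50 := by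
  classical
  have h0 := P.h0
  have h1 := fib_sum y _ hy (fun z => if ω (w, z) = 0 then 1 else 0)
  have h2 := hG.row w
  rw [D1_eq, cnt_real]
  rw [cnt_real] at h2
  push_cast at h1
  refine h1.trans ?_
  calc _ ≤ 20 * h ^ 4 * (3 * g * h ^ 46) := by gcongr
    _ = _ := by ring

lemma D1_sq {ω : Mat r q} (hG : Good1 a s0 h g ω) (y : Fin a → Fin r)
    (hy : Mult y (20 * h ^ 4)) : ∑ w, (D1 ω y w : ℝ) ^ 2 ≤ (a:ℝ) ^ 2 / 64 := by
  classical
  have h0 := P.h0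
  have hh1 := P.h1
  have hg1 := P.g1
  set W : Finset (Fin r) := univ.filter (fun w => ¬ (D1 ω y w : ℝ) ≤ h ^ 6) with hWd
  have hW : W.card ≤ s0 := by
    by_contra hcon
    push Not at hcon
    obtain ⟨W0, hW0, hc⟩ := Finset.exists_subset_card_eq hcon.le
    have h1 := P.heavy_sum hG y hy W0 hc.le
    have h2 : (s0:ℝ) * h ^ 6 ≤ ∑ w ∈ W0, (D1 ω y w : ℝ) := by
      rw [← hc, ← nsmul_eq_mul]
      refine Finset.card_nsmul_le_sum _ _ _ (fun w hw => ?_)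
      have := hW0 hw
      simp only [hWd, mem_filter, not_le] at this
      exact this.2.le
    have h3 : h ^ 45 / 2 * h ^ 6 ≤ 97 * (2 * 10 ^ 6 * g * h ^ 50) := by
      calc h ^ 45 / 2 * h ^ 6 ≤ (s0:ℝ) * h ^ 6 := by gcongr; exact P.s1
        _ ≤ 97 * (a:ℝ) := h2.trans h1
        _ ≤ _ := by gcongr; exact P.a2
    have h4 : h * h ^ 50 ≤ (97 * 4 * 10 ^ 6 * g) * h ^ 50 := by nlinarith
    have h5 : h ≤ 97 * 4 * 10 ^ 6 * g := le_of_mul_le_mul_right h4 (by positivity)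
    have := P.gg
    linarith
  have h1 := P.heavy_sum hG y hy W hW
  have h2 := hG.light y hy
  have h3 : ∑ w ∈ W, (D1 ω y w : ℝ) ^ 2 ≤ (a:ℝ) ^ 2 / 128 := by
    calc ∑ w ∈ W, (D1 ω y w : ℝ) ^ 2 ≤ ∑ w ∈ W, 60 * g * h ^ 50 * (D1 ω y w : ℝ) := by
          refine Finset.sum_le_sum fun w _ => ?_
          rw [sq]
          gcongr
          exact P.D1_le hG y hy w
      _ = 60 * g * h ^ 50 * ∑ w ∈ W, (D1 ω y w : ℝ) := by rw [Finset.mul_sum]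
      _ ≤ 60 * g * h ^ 50 * (97 * a) := by gcongr
      _ = 5820 / 10 ^ 6 * (10 ^ 6 * g * h ^ 50) * a := by ring
      _ ≤ 5820 / 10 ^ 6 * a * a := by gcongr; exact P.a1
      _ ≤ _ := by nlinarith [sq_nonneg (a:ℝ)]
  rw [hWd, Finset.sum_filter] at h3
  have h4 : ∀ w, (D1 ω y w : ℝ) ^ 2 = (if (D1 ω y w : ℝ) ≤ h ^ 6 then (D1 ω y w : ℝ) ^ 2 else 0)
      + (if ¬ (D1 ω y w : ℝ) ≤ h ^ 6 then (D1 ω y w : ℝ) ^ 2 else 0) := by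
    intro w; by_cases hw : (D1 ω y w : ℝ) ≤ h ^ 6 <;> simp [hw]
  rw [Finset.sum_congr rfl (fun w _ => h4 w), Finset.sum_add_distrib]
  have h5 : ∑ w, (if (D1 ω y w : ℝ) ≤ h ^ 6 then (D1 ω y w : ℝ) ^ 2 else 0) < (a:ℝ) ^ 2 / 128 := by
    convert h2
  linarith

end Par

/-- A matrix that is good together with its transpose. -/
def Good (a s0 : ℕ) (h g : ℝ) (ω : Mat r q) : Prop := Good1 a s0 h g ω ∧ Good1 a s0 h g (tr ω)

lemma cnt_or {ι : Type*} [Fintype ι] (s t : ι → Prop) : cnt (fun i => s i ∨ t i) ≤ cnt s + cnt t := by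
  classical
  rw [cnt_eq, cnt_eq, cnt_eq, Finset.filter_or]
  exact card_union_le _ _

lemma cnt_prod {ι κ : Type*} [Fintype ι] [Fintype κ] (s : ι → Prop) (t : κ → Prop) :
    cnt (fun e : ι × κ => s e.1 ∧ t e.2) = cnt s * cnt t := by
  classical
  rw [cnt_eq, cnt_eq, cnt_eq, ← Finset.card_product]
  congr 1
  ext e; simp

lemma cnt_exists {ι κ : Type*} [Fintype ι] [Fintype κ] (s : κ → ι → Prop) :
    cnt (fun i => ∃ w, s w i) ≤ ∑ w, cnt (s w) := by
  classical
  simp only [cnt_eq]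
  refine le_trans (card_le_card ?_) (Finset.card_biUnion_le (s := univ)
    (t := fun w => univ.filter (s w)))
  intro i hi
  simpa using hi

namespace Par
variable (P : Par n r q a s0 h g p)
include P

lemma good_tail : Pr (fun ω : Mat r q => ¬ Good a s0 h g ω) ≤ 6 * Real.exp (- h) := by
  have h1 := P.good1_tail
  have h2 := P.good1_tail
  rw [← Pr_tr] at h2
  refine le_trans (Pr_mono fun ω hω => ?_) (((Pr_or _ _).trans (add_le_add h1 h2)).trans
    (le_of_eq (by ring)))
  unfold Good at hω
  tauto

lemma cl_count {ω : Mat r q} (hG : Good a s0 h g ω) (y : Fin a → Fin r)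
    (hy : Mult y (20 * h ^ 4)) :
    (cnt (fun e : Fin a × Fin a => cl ω (y e.1) (y e.2)) : ℝ) ≤ (a:ℝ) ^ 2 / 16 := by
  have h1 := P.D1_sq hG.1 y hy
  have h2 := P.D1_sq hG.2 y hy
  have h3 : cnt (fun e : Fin a × Fin a => cl ω (y e.1) (y e.2))
      ≤ ∑ w, cnt (fun i => adj ω w (y i)) * cnt (fun i => adj ω w (y i)) := by
    refine (cnt_exists (fun w (e : Fin a × Fin a) => adj ω w (y e.1) ∧ adj ω w (y e.2))).trans ?_
    refine Finset.sum_le_sum fun w _ => ?_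
    rw [← cnt_prod]
  have h4 : ∀ w, cnt (fun i => adj ω w (y i)) ≤ D1 ω y w + D1 (tr ω) y w := by
    intro w
    rw [D1_eq, D1_eq]
    refine (cnt_mono ?_).trans (cnt_or _ _)
    rintro i (hi | hi)
    · exact Or.inl hi.2
    · exact Or.inr hi.2
  have h5 : ∀ w, ((cnt (fun i => adj ω w (y i)) : ℝ) * cnt (fun i => adj ω w (y i)))
      ≤ 2 * (D1 ω y w : ℝ) ^ 2 + 2 * (D1 (tr ω) y w : ℝ) ^ 2 := by
    intro w
    have e : (cnt (fun i => adj ω w (y i)) : ℝ) ≤ D1 ω y w + D1 (tr ω) y w := by exact_mod_cast h4 w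
    have e0 : (0:ℝ) ≤ cnt (fun i => adj ω w (y i)) := by positivity
    nlinarith [sq_nonneg ((D1 ω y w : ℝ) - D1 (tr ω) y w)]
  calc (cnt (fun e : Fin a × Fin a => cl ω (y e.1) (y e.2)) : ℝ)
      ≤ ∑ w, (cnt (fun i => adj ω w (y i)) : ℝ) * cnt (fun i => adj ω w (y i)) := by exact_mod_cast h3
    _ ≤ ∑ w, (2 * (D1 ω y w : ℝ) ^ 2 + 2 * (D1 (tr ω) y w : ℝ) ^ 2) :=
        Finset.sum_le_sum fun w _ => h5 w
    _ = 2 * ∑ w, (D1 ω y w : ℝ) ^ 2 + 2 * ∑ w, (D1 (tr ω) y w : ℝ) ^ 2 := by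
        rw [Finset.sum_add_distrib, Finset.mul_sum, Finset.mul_sum]
    _ ≤ _ := by linarith

end Par

end TwoBites
end


noncomputable section

namespace TwoBites

open Finset

variable {n r q a s0 : ℕ} {h g p : ℝ}

/-- `v` enumerates a set whose first-colour edges are all destroyed. -/
def IndepBad (ρ β : Fin n → Fin r) (ω ω' : Mat r q) (v : Fin a → Fin n) : Prop :=
  Function.Injective (fun i => ρ (v i)) ∧ ∀ i j, ρ (v j) < ρ (v i) → ω (ρ (v i), ρ (v j)) = 0 →
    ¬ cl ω' (β (v i)) (β (v j)) → up ω (ρ (v i)) (ρ (v j))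

lemma cnt_swap (s : Fin a → Fin a → Prop) :
    cnt (fun e : Fin a × Fin a => s e.1 e.2) = cnt (fun e : Fin a × Fin a => s e.2 e.1) := by
  classical
  rw [cnt_eq, cnt_eq]
  refine Finset.card_bij' (fun e _ => e.swap) (fun e _ => e.swap) ?_ ?_ ?_ ?_ <;> simp

lemma cnt_lt_pairs (x : Fin a → Fin r) (hx : Function.Injective x) :
    (a:ℝ) ^ 2 ≤ 2 * cnt (fun e : Fin a × Fin a => x e.2 < x e.1) + a := by
  classical
  have h1 : cnt (fun _ : Fin a × Fin a => True) ≤ cnt (fun e : Fin a × Fin a => x e.2 < x e.1) +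
      (cnt (fun e : Fin a × Fin a => x e.1 < x e.2) + cnt (fun e : Fin a × Fin a => e.1 = e.2)) := by
    refine le_trans (cnt_mono fun e _ => ?_) ((cnt_or _ _).trans (Nat.add_le_add_left (cnt_or _ _) _))
    rcases lt_trichotomy (x e.2) (x e.1) with hh | hh | hh
    · exact Or.inl hh
    · exact Or.inr (Or.inr (hx hh).symm)
    · exact Or.inr (Or.inl hh)
  have h2 : cnt (fun _ : Fin a × Fin a => True) = a * a := by
    rw [cnt_eq]; simp
  have h3 := cnt_swap (a := a) (fun i j => x i < x j)
  have h4 : cnt (fun e : Fin a × Fin a => e.1 = e.2) ≤ a := by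
    rw [cnt_eq]
    have : (univ.filter (fun e : Fin a × Fin a => e.1 = e.2)) ⊆ univ.image (fun i : Fin a => (i, i)) := by
      intro e he
      simp only [mem_filter, mem_univ, true_and] at he
      exact mem_image.mpr ⟨e.1, mem_univ _, by ext <;> simp [he]⟩
    exact (card_le_card this).trans (card_image_le.trans (by simp))
  have h5 : a * a ≤ 2 * cnt (fun e : Fin a × Fin a => x e.2 < x e.1) + a := by omega
  rw [sq]; exact_mod_cast h5

lemma mult_of_fib (β : Fin n → Fin r) {M : ℝ} (hβ : Fib β M) (v : Fin a → Fin n)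
    (hv : Function.Injective v) : Mult (fun i => β (v i)) M := by
  classical
  rw [Mult_iff]
  intro z
  refine le_trans ?_ (hβ z)
  rw [cnt_eq, cnt_eq, ← card_image_of_injective _ hv]
  norm_cast
  refine card_le_card ?_
  intro w hw
  simp only [mem_image, mem_filter, mem_univ, true_and] at hw ⊢
  obtain ⟨i, hi, rfl⟩ := hw
  exact hi

lemma mult_inj (x : Fin a → Fin r) (hx : Function.Injective x) {M : ℝ} (hM : 1 ≤ M) : Mult x M := by
  classical
  rw [Mult_iff]
  intro z
  refine le_trans ?_ hM
  rw [cnt_eq]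
  norm_cast
  rw [Finset.card_le_one]
  intro i hi j hj
  simp only [mem_filter, mem_univ, true_and] at hi hj
  exact hx (hi.trans hj.symm)

namespace Par
variable (P : Par n r q a s0 h g p)
include P

lemma pm {m : ℕ} (hm : (a:ℝ) ^ 2 / 8 ≤ m) : 2 * g ^ 2 * a + h ≤ p * m := by
  have h0 := P.h0
  have hh1 := P.h1
  have hg1 := P.g1
  have hp0 := P.p0
  have e1 : 10 ^ 6 * g ^ 2 ≤ p * a := by
    calc 10 ^ 6 * g ^ 2 = 10 ^ 6 * g * g := by ring
      _ ≤ 10 ^ 6 * g * (p * h ^ 50) := by gcongr; exact P.p1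
      _ = p * (10 ^ 6 * g * h ^ 50) := by ring
      _ ≤ p * a := by gcongr; exact P.a1
  have e2 : p * (a ^ 2 / 8) ≤ p * m := by gcongr
  have e3 : h ≤ a := by
    refine le_trans ?_ P.a1
    have : h ≤ h ^ 50 := le_self_pow₀ (by linarith) (by norm_num)
    have : 1 * h ^ 50 ≤ 10 ^ 6 * g * h ^ 50 := by gcongr; linarith
    linarith
  have e4 : 1 * (a:ℝ) ≤ g ^ 2 * a := by gcongr; exact one_le_pow₀ hg1
  have e5 : 10 ^ 6 * g ^ 2 * a ≤ p * a * a := by gcongr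
  nlinarith

lemma alpha_tail {ρ β : Fin n → Fin r} (hβ : Fib β (20 * h ^ 4)) (ω' : Mat r q)
    (hG : Good a s0 h g ω') (v : Fin a → Fin n) :
    Pr (fun ω : Mat r q => Good a s0 h g ω ∧ IndepBad ρ β ω ω' v)
      ≤ Real.exp (- g ^ 2 * a - h) := by
  classical
  have hg1 := P.g1
  have h0 := P.h0
  have hh1 := P.h1
  have hg0 := P.g0
  have ha8 : (16:ℝ) ≤ a := by
    refine le_trans ?_ P.a1
    have := P.hk 50
    have : 1 * 1 ≤ g * h ^ 50 := by gcongr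
    nlinarith
  by_cases hinj : Function.Injective (fun i => ρ (v i))
  swap
  · refine le_trans (Pr_le_Ex (f := fun _ => 0) (fun _ => le_refl _) ?_) ?_
    · intro ω hω; exact absurd hω.2.1 hinj
    · unfold Ex; simp; positivity
  have hv : Function.Injective v := fun i j hij => hinj (by simp [hij])
  set x : Fin a → Fin r := fun i => ρ (v i) with hx
  set m : ℕ := ⌊(a:ℝ) ^ 2 / 4⌋₊ with hm
  have hm1 : (m:ℝ) ≤ (a:ℝ) ^ 2 / 4 := Nat.floor_le (by positivity)
  have hm2 : (a:ℝ) ^ 2 / 8 ≤ m := by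
    have := Nat.lt_floor_add_one ((a:ℝ) ^ 2 / 4)
    rw [← hm] at this
    nlinarith
  set Q : Finset (Fin r × Fin r) := (univ.filter (fun e : Fin a × Fin a => x e.2 < x e.1 ∧
    ¬ cl ω' (β (v e.1)) (β (v e.2)))).image (fun e => (x e.1, x e.2)) with hQ
  have hp0 := P.p0
  have hp1 : p < 1 := by
    have h2 := P.p2
    have h3 := P.gg
    have h4 : h ≤ h ^ 50 := le_self_pow₀ (by linarith) (by norm_num)
    by_contra hc
    push Not at hc
    nlinarith
  have key := alpha_one (q := q) Q (by
    intro e he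
    simp only [hQ, mem_image, mem_filter, mem_univ, true_and] at he
    obtain ⟨e', he', rfl⟩ := he
    exact he'.1) m p P.hp hp1
  have hbound : (1 - p) ^ m ≤ Real.exp (- g ^ 2 * a - h) := by
    calc (1 - p) ^ m ≤ Real.exp (-p) ^ m := by
          apply pow_le_pow_left₀ (by linarith)
          linarith [Real.add_one_le_exp (-p)]
      _ = Real.exp (-(p * m)) := by rw [← Real.exp_nat_mul]; ring_nf
      _ ≤ _ := by
          apply Real.exp_le_exp.mpr
          have := P.pm hm2
          have e4 : 0 ≤ g ^ 2 * (a:ℝ) := by positivity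
          linarith
  refine le_trans (Pr_mono fun ω hω => ?_) (key.trans hbound)
  obtain ⟨hGω, _, hI⟩ := hω
  refine ⟨?_, ?_⟩
  · intro e he
    simp only [hQ, mem_image, mem_filter, mem_univ, true_and] at he
    obtain ⟨e', he', rfl⟩ := he
    exact fun h0 => hI _ _ he'.1 h0 he'.2
  · have c1 := P.cl_count hG (fun i => β (v i)) (mult_of_fib β hβ v hv)
    have c2 := P.cl_count hGω x (mult_inj x hinj (by have := P.hk 4; linarith))
    have c3 := cnt_lt_pairs x hinj
    have c4 : cnt (fun e : Fin a × Fin a => x e.2 < x e.1) ≤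
        cnt (fun e : Fin a × Fin a => (x e.2 < x e.1 ∧ ¬ cl ω' (β (v e.1)) (β (v e.2))) ∧
          ¬ up ω (x e.1) (x e.2)) +
        (cnt (fun e : Fin a × Fin a => cl ω' (β (v e.1)) (β (v e.2))) +
          cnt (fun e : Fin a × Fin a => cl ω (x e.1) (x e.2))) := by
      refine le_trans (cnt_mono fun e he => ?_)
        ((cnt_or _ _).trans (Nat.add_le_add_left (cnt_or _ _) _))
      by_cases h1 : cl ω' (β (v e.1)) (β (v e.2))
      · exact Or.inr (Or.inl h1)
      by_cases h2 : up ω (x e.1) (x e.2)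
      · exact Or.inr (Or.inr (up_cl h2))
      · exact Or.inl ⟨⟨he, h1⟩, h2⟩
    have c5 : cnt (fun e : Fin a × Fin a => (x e.2 < x e.1 ∧ ¬ cl ω' (β (v e.1)) (β (v e.2))) ∧
          ¬ up ω (x e.1) (x e.2)) ≤ (Q.filter (fun e => ¬ up ω e.1 e.2)).card := by
      have hφ : Function.Injective (fun e : Fin a × Fin a => (x e.1, x e.2)) := by
        intro e e' hee
        simp only [Prod.mk.injEq] at hee
        exact Prod.ext (hinj hee.1) (hinj hee.2)
      rw [cnt_eq, ← card_image_of_injective _ hφ]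
      refine card_le_card ?_
      intro z hz
      simp only [mem_image, mem_filter, mem_univ, true_and, hQ] at hz ⊢
      obtain ⟨e, he, rfl⟩ := hz
      exact ⟨⟨e, he.1, rfl⟩, he.2⟩
    have c6 := c4.trans (Nat.add_le_add_right c5 _)
    have c7 : (cnt (fun e : Fin a × Fin a => x e.2 < x e.1) : ℝ) ≤
        ((Q.filter (fun e => ¬ up ω e.1 e.2)).card : ℝ) +
        (cnt (fun e : Fin a × Fin a => cl ω' (β (v e.1)) (β (v e.2))) +
          cnt (fun e : Fin a × Fin a => cl ω (x e.1) (x e.2))) := by exact_mod_cast c6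
    have c8 : (m:ℝ) ≤ ((Q.filter (fun e => ¬ up ω e.1 e.2)).card : ℝ) := by nlinarith
    have c9 : m ≤ (Q.filter (fun e => ¬ up ω e.1 e.2)).card := by exact_mod_cast c8
    convert c9

lemma alpha_union {ρ β : Fin n → Fin r} (hβ : Fib β (20 * h ^ 4)) (ω' : Mat r q)
    (hG : Good a s0 h g ω') :
    Pr (fun ω : Mat r q => ∃ v : Fin a → Fin n, Good a s0 h g ω ∧ IndepBad ρ β ω ω' v)
      ≤ Real.exp (- h) := by
  refine (Pr_exists _ (fun v => P.alpha_tail hβ ω' hG v)).trans ?_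
  simp only [Fintype.card_pi, Fintype.card_fin, Finset.prod_const, Finset.card_univ]
  push_cast
  rw [P.hg, ← Real.exp_nat_mul, ← Real.exp_add]
  apply Real.exp_le_exp.mpr
  apply le_of_eq; ring

end Par

end TwoBites
end


noncomputable section

namespace TwoBites

open Finset

variable {n r q a s0 : ℕ} {h g p : ℝ}

/-- The matrix entry that encodes the pair `{x, y}`. -/
def ent (x y : Fin r) : Fin r × Fin r := if y < x then (x, y) else (y, x)

lemma adj_ent (ω : Mat r q) {x y : Fin r} (hxy : y ≠ x) : adj ω x y ↔ ω (ent x y) = 0 := by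
  unfold adj ent
  rcases lt_or_gt_of_ne hxy with h | h
  · simp [h, h.not_gt]
  · simp [h, h.not_gt]

lemma ent_inj (x : Fin r) : Set.InjOn (ent x) ((univ.erase x : Finset (Fin r)) : Set (Fin r)) := by
  intro y hy y' hy' hh
  simp only [coe_erase, coe_univ, Set.mem_sdiff, Set.mem_univ, Set.mem_singleton_iff, true_and] at hy hy'
  unfold ent at hh
  split_ifs at hh <;> simp only [Prod.mk.injEq] at hh <;> grind

open Classical in
lemma cnt_fiber (ρ : Fin n → Fin r) (Z : Fin n → Prop) (A : Fin r → Prop) :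
    (cnt (fun u => Z u ∧ A (ρ u)) : ℝ) =
      ∑ x, if A x then (cnt (fun u => Z u ∧ ρ u = x) : ℝ) else 0 := by
  rw [cnt_real, ← Finset.sum_fiberwise (s := univ) (g := ρ)]
  refine Finset.sum_congr rfl fun x _ => ?_
  rw [cnt_real, Finset.sum_filter]
  by_cases hA : A x
  · rw [if_pos hA]
    refine Finset.sum_congr rfl fun u _ => ?_
    by_cases hu : ρ u = x <;> simp [hu, hA]
  · rw [if_neg hA]
    refine Finset.sum_eq_zero fun u _ => ?_
    by_cases hu : ρ u = x <;> simp [hu, hA]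

lemma cnt_adj_sum (ρ : Fin n → Fin r) (Z : Fin n → Prop) (ω : Mat r q) (x : Fin r) :
    (cnt (fun u => Z u ∧ adj ω x (ρ u)) : ℝ) = ∑ y ∈ univ.erase x,
      if ω (ent x y) = 0 then (cnt (fun u => Z u ∧ ρ u = y) : ℝ) else 0 := by
  classical
  rw [cnt_fiber ρ Z (adj ω x), ← Finset.sum_erase_add _ _ (mem_univ x), if_neg adj_irrefl, add_zero]
  refine Finset.sum_congr rfl fun y hy => ?_
  simp only [adj_ent ω (ne_of_mem_erase hy)]

lemma cnt_sum (ρ : Fin n → Fin r) (Z : Fin n → Prop) :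
    ∑ y, (cnt (fun u => Z u ∧ ρ u = y) : ℝ) = cnt Z := by
  have := cnt_fiber ρ Z (fun _ => True)
  simpa using this.symm

lemma cnt_fib_le {ρ : Fin n → Fin r} {M : ℝ} (hρ : Fib ρ M) (Z : Fin n → Prop) (y : Fin r) :
    (cnt (fun u => Z u ∧ ρ u = y) : ℝ) ≤ M := by
  refine le_trans ?_ (hρ y)
  have : cnt (fun u => Z u ∧ ρ u = y) ≤ cnt (fun u => ρ u = y) := cnt_mono fun u hu => hu.2
  exact_mod_cast this

/-- the number of vertices mapped into a small set -/
lemma cnt_pre_le {ρ : Fin n → Fin r} {M : ℝ} (hρ : Fib ρ M) (A : Fin r → Prop) :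
    (cnt (fun u => A (ρ u)) : ℝ) ≤ M * cnt A := by
  classical
  have h1 := cnt_fiber ρ (fun _ => True) A
  simp only [true_and] at h1
  rw [h1, cnt_real, Finset.mul_sum]
  refine Finset.sum_le_sum fun x _ => ?_
  split_ifs
  · simpa using hρ x
  · simp

namespace Par
variable (P : Par n r q a s0 h g p)
include P

lemma p_n : p * n ≤ 2 * g * h ^ 50 := by
  rw [P.hn]
  have := P.p2
  have := P.hk 50
  calc p * h ^ 100 = p * h ^ 50 * h ^ 50 := by ring
    _ ≤ _ := by gcongr

lemma tail_exponent {s : ℝ} (hs0 : 0 ≤ s) (hs : s ≤ n) :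
    ((h ^ 48)⁻¹) ^ 2 * p * (20 * h ^ 4) * s - (h ^ 48)⁻¹ * h ^ 49 ≤ 1 - h := by
  have h0 := P.h0
  have hp0 := P.p0
  have e1 : (h ^ 48)⁻¹ * h ^ 49 = h := by field_simp
  have e2 : ((h ^ 48)⁻¹) ^ 2 * p * (20 * h ^ 4) * s ≤ 1 := by
    calc ((h ^ 48)⁻¹) ^ 2 * p * (20 * h ^ 4) * s ≤ ((h ^ 48)⁻¹) ^ 2 * p * (20 * h ^ 4) * n := by gcongr
      _ = ((h ^ 48)⁻¹) ^ 2 * (20 * h ^ 4) * (p * n) := by ring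
      _ ≤ ((h ^ 48)⁻¹) ^ 2 * (20 * h ^ 4) * (2 * g * h ^ 50) :=
          mul_le_mul_of_nonneg_left P.p_n (by positivity)
      _ = 40 * g / h ^ 42 := by field_simp; ring
      _ ≤ 1 := by
        rw [div_le_one (by positivity)]
        have : h ≤ h ^ 42 := le_self_pow₀ (by have := P.h1; linarith) (by norm_num)
        have := P.gg
        have := P.g0
        linarith
  linarith

lemma lMx : (h ^ 48)⁻¹ * (20 * h ^ 4) ≤ 1 := by
  have h0 := P.h0
  rw [inv_mul_le_iff₀ (by positivity), mul_one]
  have e : h ^ 48 = h ^ 43 * h * h ^ 4 := by ring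
  rw [e]
  gcongr
  have := P.hk 43
  have := P.h1
  nlinarith

lemma tailU {ι J : Type*} [Fintype ι] [DecidableEq ι] (S : Finset J) (φ : J → ι) (hφ : Set.InjOn φ S)
    (m : J → ℝ) (hm0 : ∀ j ∈ S, 0 ≤ m j) (hm : ∀ j ∈ S, m j ≤ 20 * h ^ 4)
    (hs : ∑ j ∈ S, m j ≤ n) :
    Pr (fun ω : ι → Fin (q + 1) =>
        p * (∑ j ∈ S, m j) + h ^ 49 ≤ ∑ j ∈ S, (if ω (φ j) = 0 then m j else 0))
      ≤ Real.exp (1 - h) := by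
  have h0 := P.h0
  exact (tail_upper S φ hφ m (20 * h ^ 4) (h ^ 48)⁻¹ p (h ^ 49) P.hp hm0 hm (by positivity)
    P.lMx).trans (Real.exp_le_exp.mpr (P.tail_exponent (Finset.sum_nonneg hm0) hs))

lemma tailL {ι J : Type*} [Fintype ι] [DecidableEq ι] (S : Finset J) (φ : J → ι) (hφ : Set.InjOn φ S)
    (m : J → ℝ) (hm0 : ∀ j ∈ S, 0 ≤ m j) (hm : ∀ j ∈ S, m j ≤ 20 * h ^ 4)
    (hs : ∑ j ∈ S, m j ≤ n) :
    Pr (fun ω : ι → Fin (q + 1) =>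
        ∑ j ∈ S, (if ω (φ j) = 0 then m j else 0) ≤ p * (∑ j ∈ S, m j) - h ^ 49)
      ≤ Real.exp (1 - h) := by
  have h0 := P.h0
  exact (tail_lower S φ hφ m (20 * h ^ 4) (h ^ 48)⁻¹ p (h ^ 49) P.hp hm0 hm (by positivity)
    P.lMx).trans (Real.exp_le_exp.mpr (P.tail_exponent (Finset.sum_nonneg hm0) hs))

lemma p_98 {s : ℝ} (hs : s ≤ h ^ 98) : p * s ≤ h ^ 49 := by
  have h0 := P.h0
  have hp0 := P.p0
  calc p * s ≤ p * h ^ 98 := by gcongr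
    _ = p * h ^ 50 * h ^ 48 := by ring
    _ ≤ 2 * g * h ^ 48 := mul_le_mul_of_nonneg_right P.p2 (by positivity)
    _ ≤ h * h ^ 48 := by
        gcongr
        linarith [P.gg, P.g0]
    _ = h ^ 49 := by ring

lemma n98 : h ^ 98 ≤ n := by
  rw [P.hn]
  exact pow_le_pow_right₀ (by have := P.h1; linarith) (by norm_num)

lemma tailS {ι J : Type*} [Fintype ι] [DecidableEq ι] (S : Finset J) (φ : J → ι) (hφ : Set.InjOn φ S)
    (m : J → ℝ) (hm0 : ∀ j ∈ S, 0 ≤ m j) (hm : ∀ j ∈ S, m j ≤ 20 * h ^ 4)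
    (hs : ∑ j ∈ S, m j ≤ h ^ 98) :
    Pr (fun ω : ι → Fin (q + 1) => 2 * h ^ 49 ≤ ∑ j ∈ S, (if ω (φ j) = 0 then m j else 0))
      ≤ Real.exp (1 - h) := by
  refine le_trans (Pr_mono fun ω hω => ?_) (P.tailU S φ hφ m hm0 hm (hs.trans P.n98))
  have := P.p_98 hs
  linarith

lemma deg_tail {ρ : Fin n → Fin r} (hρ : Fib ρ (20 * h ^ 4)) (x : Fin r) :
    Pr (fun ω : Mat r q => p * n + h ^ 49 ≤ cnt (fun u => adj ω x (ρ u)) ∨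
      (cnt (fun u => adj ω x (ρ u)) : ℝ) ≤ p * n - 2 * h ^ 49) ≤ 2 * Real.exp (1 - h) := by
  have h0 := P.h0
  have hp0 := P.p0
  set m : Fin r → ℝ := fun y => cnt (fun u => True ∧ ρ u = y) with hm
  have hsum : ∑ y ∈ univ.erase x, m y + m x = n := by
    rw [Finset.sum_erase_add _ _ (mem_univ x), hm]
    dsimp only
    rw [cnt_sum ρ (fun _ => True), cnt_eq]; simp
  have hm0 : ∀ y, 0 ≤ m y := fun y => by rw [hm]; positivity
  have hmM : ∀ y, m y ≤ 20 * h ^ 4 := fun y => cnt_fib_le hρ _ y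
  have hs : ∑ y ∈ univ.erase x, m y ≤ n := by linarith [hm0 x]
  have h1 := P.tailU (univ.erase x) (ent x) (ent_inj x) m (fun y _ => hm0 y) (fun y _ => hmM y) hs
  have h2 := P.tailL (univ.erase x) (ent x) (ent_inj x) m (fun y _ => hm0 y) (fun y _ => hmM y) hs
  have hpx : p * m x ≤ h ^ 49 := by
    apply P.p_98
    refine (hmM x).trans ?_
    calc 20 * h ^ 4 ≤ h * h ^ 4 := by gcongr; linarith [P.h1]
      _ = h ^ 5 := by ring
      _ ≤ h ^ 98 := pow_le_pow_right₀ (by linarith [P.h1]) (by norm_num)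
  have hpx0 : 0 ≤ p * m x := mul_nonneg hp0 (hm0 x)
  have hpn : p * n = p * ∑ y ∈ univ.erase x, m y + p * m x := by rw [← hsum]; ring
  refine le_trans (Pr_mono fun ω hω => ?_)
    (((Pr_or _ _).trans (add_le_add h1 h2)).trans (le_of_eq (by ring)))
  have e := cnt_adj_sum ρ (fun _ => True) ω x
  simp only [true_and] at e
  have e' : (cnt (fun u => adj ω x (ρ u)) : ℝ) =
      ∑ y ∈ univ.erase x, if ω (ent x y) = 0 then m y else 0 := by
    rw [e, hm]; simp only [true_and]
  rw [e'] at hω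
  rcases hω with hω | hω
  · left; linarith
  · right; linarith

/-- neighbourhood size -/
lemma nbr {ω : Mat r q} (hG : Good a s0 h g ω) (x : Fin r) :
    (cnt (fun y => adj ω x y) : ℝ) ≤ 6 * g * h ^ 46 := by
  have h1 := hG.1.row x
  have h2 := hG.2.row x
  have h3 : cnt (fun y => adj ω x y) ≤ cnt (fun y => ω (x, y) = 0) + cnt (fun y => tr ω (x, y) = 0) := by
    refine le_trans (cnt_mono fun y hy => ?_) (cnt_or _ _)
    rcases hy with hy | hy
    · exact Or.inl hy.2
    · exact Or.inr hy.2
  have h4 : (cnt (fun y => adj ω x y) : ℝ) ≤ cnt (fun y => ω (x, y) = 0) +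
    cnt (fun y => tr ω (x, y) = 0) := by exact_mod_cast h3
  linarith

lemma six : (6 * g * h ^ 46) * (6 * g * h ^ 46) * (20 * h ^ 4) * 2 ≤ h ^ 98 := by
  have h0 := P.h0
  calc (6 * g * h ^ 46) * (6 * g * h ^ 46) * (20 * h ^ 4) * 2 = 1440 * g ^ 2 * h ^ 96 := by ring
    _ ≤ h ^ 2 * h ^ 96 := by
        gcongr
        nlinarith [P.gg2, P.h1]
    _ = h ^ 98 := by ring

end Par

open Classical in
/-- Ordered pairs of neighbours of `x`. -/
def NP (ω : Mat r q) (x : Fin r) : Finset (Fin r × Fin r) :=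
  univ.filter (fun e => (adj ω x e.1 ∧ adj ω x e.2) ∧ e.2 < e.1)

lemma NP_card (ω : Mat r q) (x : Fin r) :
    (NP ω x).card ≤ cnt (fun y => adj ω x y) * cnt (fun y => adj ω x y) := by
  classical
  rw [← cnt_prod, cnt_eq, NP]
  refine card_le_card fun e he => ?_
  simp only [mem_filter, mem_univ, true_and] at he ⊢
  exact he.1

lemma tri_loss {ρ : Fin n → Fin r} {M : ℝ} (hM : 0 ≤ M) (hρ : Fib ρ M) (ω : Mat r q) (x : Fin r) :
    (cnt (fun u => adj ω x (ρ u) ∧ up ω x (ρ u)) : ℝ) ≤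
      ∑ e ∈ NP ω x, if ω e = 0 then M else 0 := by
  classical
  refine (cnt_pre_le hρ (fun y => adj ω x y ∧ up ω x y)).trans ?_
  rw [← Finset.sum_filter, Finset.sum_const, nsmul_eq_mul, mul_comm]
  gcongr
  rw [cnt_eq]
  refine (card_le_card (t := ((NP ω x).filter (fun e => ω e = 0)).image Prod.snd) ?_).trans
    card_image_le
  intro y hy
  simp only [mem_filter, mem_univ, true_and] at hy
  obtain ⟨hy1, w, hw1, hw2, hw3, hw4⟩ := hy
  refine mem_image.mpr ⟨(w, y), ?_, rfl⟩
  simp only [NP, mem_filter, mem_univ, true_and]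
  exact ⟨⟨⟨Or.inr ⟨hw1, hw3⟩, hy1⟩, hw2⟩, hw4⟩

namespace Par
variable (P : Par n r q a s0 h g p)
include P

lemma tri_tail (x : Fin r) :
    Pr (fun ω : Mat r q => (cnt (fun y => adj ω x y) : ℝ) ≤ 6 * g * h ^ 46 ∧
      2 * h ^ 49 ≤ ∑ e ∈ NP ω x, if ω e = 0 then 20 * h ^ 4 else 0) ≤ Real.exp (1 - h) := by
  classical
  have h0 := P.h0
  refine Pr_merge_le (fun e : Fin r × Fin r => e.1 = x ∨ e.2 = x) _ (fun ω' => ?_)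
  have hadj : ∀ ω : Mat r q, ∀ y, adj (merge (fun e : Fin r × Fin r => e.1 = x ∨ e.2 = x) ω' ω) x y
      ↔ adj ω' x y := by
    intro ω y
    simp [adj, merge]
  have hNP : ∀ ω : Mat r q, NP (merge (fun e : Fin r × Fin r => e.1 = x ∨ e.2 = x) ω' ω) x
      = NP ω' x := by
    intro ω
    simp only [NP, hadj]
  simp only [hadj, hNP]
  by_cases hN : (cnt (fun y => adj ω' x y) : ℝ) ≤ 6 * g * h ^ 46
  swap
  · refine le_trans (Pr_le_Ex (f := fun _ => 0) (fun _ => le_refl _) ?_) ?_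
    · intro ω hω; exact absurd hω.1 hN
    · unfold Ex; simp; positivity
  refine le_trans (Pr_mono fun ω hω => ?_) (P.tailS (NP ω' x) (fun e => e) (fun _ _ _ _ h => h)
    (fun _ => 20 * h ^ 4) (fun _ _ => by positivity) (fun _ _ => le_refl _) ?_)
  · refine hω.2.trans (le_of_eq (Finset.sum_congr rfl fun e he => ?_))
    have : merge (fun e : Fin r × Fin r => e.1 = x ∨ e.2 = x) ω' ω e = ω e := by
      simp only [NP, mem_filter, mem_univ, true_and] at he
      have h1 : e.1 ≠ x := fun hh => adj_irrefl (hh ▸ he.1.1)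
      have h2 : e.2 ≠ x := fun hh => adj_irrefl (hh ▸ he.1.2)
      simp [merge, h1, h2]
    rw [this]
  · rw [Finset.sum_const, nsmul_eq_mul]
    refine le_trans ?_ P.six
    have h1 : ((NP ω' x).card : ℝ) ≤ (cnt (fun y => adj ω' x y) : ℝ) * cnt (fun y => adj ω' x y) := by
      exact_mod_cast NP_card ω' x
    have h2 : ((NP ω' x).card : ℝ) ≤ (6 * g * h ^ 46) * (6 * g * h ^ 46) := by
      refine h1.trans ?_
      have := P.g0
      gcongr
    have h3 : ((NP ω' x).card : ℝ) * (20 * h ^ 4) ≤ (6 * g * h ^ 46) * (6 * g * h ^ 46) * (20 * h ^ 4) := by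
      gcongr
    have h4 : 0 ≤ (6 * g * h ^ 46) * (6 * g * h ^ 46) * (20 * h ^ 4) := by
      have := P.g0
      positivity
    linarith

lemma near_count {ω' : Mat r q} (hG : Good a s0 h g ω') (y0 : Fin r) :
    (cnt (fun y => cl ω' y y0 ∨ adj ω' y y0) : ℝ) ≤ (6 * g * h ^ 46) * (6 * g * h ^ 46) * 2 := by
  classical
  set N := 6 * g * h ^ 46 with hN
  have hg1 := P.g1
  have hN1 : 1 ≤ N := by
    have := P.hk 46
    rw [hN]; nlinarith
  have e1 : (cnt (fun y => adj ω' y y0) : ℝ) ≤ N := by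
    refine le_trans (le_of_eq ?_) (P.nbr hG y0)
    congr 1
    exact cnt_congr fun y => ⟨adj_symm, adj_symm⟩
  have e2 : (cnt (fun y => cl ω' y y0) : ℝ) ≤ N * N := by
    have h1 := cnt_exists (fun w y => adj ω' w y ∧ adj ω' w y0)
    have h2 : (cnt (fun y => cl ω' y y0) : ℝ) ≤
        ∑ w, (cnt (fun y => adj ω' w y ∧ adj ω' w y0) : ℝ) := by exact_mod_cast h1
    refine h2.trans ?_
    calc ∑ w, (cnt (fun y => adj ω' w y ∧ adj ω' w y0) : ℝ)
        ≤ ∑ w, N * (if adj ω' w y0 then (1:ℝ) else 0) := by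
          refine Finset.sum_le_sum fun w _ => ?_
          by_cases hw : adj ω' w y0
          · simp only [hw, and_true, if_true, mul_one]
            exact P.nbr hG w
          · simp only [hw, and_false, if_false, mul_zero]
            rw [cnt_eq]; simp
      _ = N * cnt (fun w => adj ω' w y0) := by rw [cnt_real, Finset.mul_sum]
      _ ≤ N * N := by gcongr
  have e3 : (cnt (fun y => cl ω' y y0 ∨ adj ω' y y0) : ℝ) ≤
      cnt (fun y => cl ω' y y0) + cnt (fun y => adj ω' y y0) := by exact_mod_cast cnt_or _ _
  nlinarith

lemma cross_tail {ρ β : Fin n → Fin r} (hρ : Fib ρ (20 * h ^ 4)) (hβ : Fib β (20 * h ^ 4))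
    {ω' : Mat r q} (hG : Good a s0 h g ω') (v : Fin n) :
    Pr (fun ω : Mat r q => 2 * h ^ 49 ≤ (cnt (fun u => (cl ω' (β u) (β v) ∨ adj ω' (β u) (β v)) ∧
      adj ω (ρ v) (ρ u)) : ℝ)) ≤ Real.exp (1 - h) := by
  have h0 := P.h0
  simp only [cnt_adj_sum ρ (fun u => cl ω' (β u) (β v) ∨ adj ω' (β u) (β v))]
  refine P.tailS (univ.erase (ρ v)) (ent (ρ v)) (ent_inj _) _ (fun y _ => by positivity)
    (fun y _ => cnt_fib_le hρ _ y) ?_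
  refine le_trans (Finset.sum_le_sum_of_subset_of_nonneg (erase_subset _ _)
    (fun _ _ _ => by positivity)) ?_
  rw [cnt_sum]
  refine (cnt_pre_le hβ (fun y => cl ω' y (β v) ∨ adj ω' y (β v))).trans (le_trans ?_ P.six)
  have := P.near_count hG (β v)
  calc _ ≤ 20 * h ^ 4 * ((6 * g * h ^ 46) * (6 * g * h ^ 46) * 2) := by gcongr
    _ = _ := by ring

end Par
end TwoBites
end


noncomputable section

namespace TwoBites

open Finset

variable {n r q a s0 : ℕ} {h g p : ℝ}

structure Side (a s0 : ℕ) (h g p : ℝ) (ρ β : Fin n → Fin r) (ω ω' : Mat r q) : Prop where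
  degU : ∀ x, (cnt (fun u => adj ω x (ρ u)) : ℝ) < p * n + h ^ 49
  degL : ∀ x, p * n - 2 * h ^ 49 < (cnt (fun u => adj ω x (ρ u)) : ℝ)
  tri : ∀ x, (cnt (fun u => adj ω x (ρ u) ∧ up ω x (ρ u)) : ℝ) < 2 * h ^ 49
  cross : ∀ v, (cnt (fun u => (cl ω' (β u) (β v) ∨ adj ω' (β u) (β v)) ∧
      adj ω (ρ v) (ρ u)) : ℝ) < 2 * h ^ 49
  alpha : ∀ v : Fin a → Fin n, ¬ IndepBad ρ β ω ω' v

namespace Par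
variable (P : Par n r q a s0 h g p)
include P

lemma small : Real.exp (g ^ 2 + (1 - h)) ≤ 1 / 100 := by
  have : g ^ 2 + (1 - h) ≤ -99 := by nlinarith [P.gg2, P.h1]
  refine (Real.exp_le_exp.mpr this).trans ?_
  rw [Real.exp_neg, inv_le_comm₀ (Real.exp_pos _) (by norm_num)]
  have := Real.add_one_le_exp (99:ℝ)
  linarith

lemma small' : Real.exp (- h) ≤ 1 / 100 := by
  refine le_trans (Real.exp_le_exp.mpr ?_) P.small
  nlinarith [P.g1]

lemma small_r : (r:ℝ) * Real.exp (1 - h) ≤ 1 / 100 := by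
  refine le_trans ?_ P.small
  rw [Real.exp_add]
  gcongr
  exact P.rn

lemma small_n : (n:ℝ) * Real.exp (1 - h) ≤ 1 / 100 := by
  refine le_trans ?_ P.small
  rw [Real.exp_add]
  gcongr
  exact P.hg.le

lemma side_tail {ρ β : Fin n → Fin r} (hρ : Fib ρ (20 * h ^ 4)) (hβ : Fib β (20 * h ^ 4))
    {ω' : Mat r q} (hG : Good a s0 h g ω') :
    Pr (fun ω : Mat r q => ¬ Side a s0 h g p ρ β ω ω') ≤ 1 / 8 := by
  have h0 := P.h0
  have b1 := P.good_tail
  have b2 := Pr_exists _ (fun x => P.deg_tail hρ x)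
  have b3 := Pr_exists _ (fun x => P.tri_tail x)
  have b4 := Pr_exists _ (fun v => P.cross_tail hρ hβ hG v)
  have b5 := P.alpha_union (ρ := ρ) hβ ω' hG
  have b6 := (Pr_or _ _).trans (add_le_add ((Pr_or _ _).trans (add_le_add ((Pr_or _ _).trans
    (add_le_add ((Pr_or _ _).trans (add_le_add b1 b2)) b3)) b4)) b5)
  simp only [Fintype.card_fin] at b6
  refine le_trans (Pr_mono fun ω hω => ?_) (b6.trans ?_)
  · by_contra hc
    push Not at hc
    obtain ⟨⟨⟨⟨c1, c2⟩, c3⟩, c4⟩, c5⟩ := hc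
    refine hω ⟨fun x => (c2 x).1, fun x => (c2 x).2, fun x => ?_, fun v => c4 v, fun v => c5 v c1⟩
    exact lt_of_le_of_lt (tri_loss (by positivity) hρ ω x) (c3 x (P.nbr c1 x))
  · have := P.small'
    have := P.small_r
    have := P.small_n
    nlinarith

lemma pair_exists {ρ β : Fin n → Fin r} (hρ : Fib ρ (20 * h ^ 4)) (hβ : Fib β (20 * h ^ 4)) :
    ∃ ω ω' : Mat r q, Side a s0 h g p ρ β ω ω' ∧ Side a s0 h g p β ρ ω' ω := by
  have b1 : Pr (fun z : Mat r q × Mat r q => ¬ Good a s0 h g z.1) ≤ 1 / 8 := by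
    refine Pr_prod_right _ (fun ω' => P.good_tail.trans ?_)
    have := P.small'
    linarith
  have b2 : Pr (fun z : Mat r q × Mat r q => ¬ Good a s0 h g z.2) ≤ 1 / 8 := by
    refine Pr_prod_left _ (fun ω' => P.good_tail.trans ?_)
    have := P.small'
    linarith
  have b3 : Pr (fun z : Mat r q × Mat r q => Good a s0 h g z.2 ∧ ¬ Side a s0 h g p ρ β z.1 z.2)
      ≤ 1 / 8 := by
    refine Pr_prod_right _ (fun ω' => ?_)
    by_cases hG : Good a s0 h g ω'
    · exact le_trans (Pr_mono fun ω hω => hω.2) (P.side_tail hρ hβ hG)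
    · refine le_trans (Pr_le_Ex (f := fun _ => 0) (fun _ => le_refl _) ?_) ?_
      · intro ω hω; exact absurd hω.1 hG
      · unfold Ex; simp
  have b4 : Pr (fun z : Mat r q × Mat r q => Good a s0 h g z.1 ∧ ¬ Side a s0 h g p β ρ z.2 z.1)
      ≤ 1 / 8 := by
    refine Pr_prod_left _ (fun ω' => ?_)
    by_cases hG : Good a s0 h g ω'
    · exact le_trans (Pr_mono fun ω hω => hω.2) (P.side_tail hβ hρ hG)
    · refine le_trans (Pr_le_Ex (f := fun _ => 0) (fun _ => le_refl _) ?_) ?_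
      · intro ω hω; exact absurd hω.1 hG
      · unfold Ex; simp
  have b6 := (Pr_or _ _).trans (add_le_add ((Pr_or _ _).trans (add_le_add ((Pr_or _ _).trans
    (add_le_add b1 b2)) b3)) b4)
  obtain ⟨z, hz⟩ := exists_of_Pr_lt_one (lt_of_le_of_lt b6 (by norm_num))
  push Not at hz
  obtain ⟨⟨⟨c1, c2⟩, c3⟩, c4⟩ := hz
  exact ⟨z.1, z.2, c3 c2, c4 c1⟩

end Par

/-- Surviving edges of one colour. -/
def Ed (ρ β : Fin n → Fin r) (ω ω' : Mat r q) (u v : Fin n) : Prop :=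
  adj ω (ρ u) (ρ v) ∧ ¬ up ω (ρ u) (ρ v) ∧ ¬ cl ω' (β u) (β v)

lemma Ed_symm {ρ β : Fin n → Fin r} {ω ω' : Mat r q} {u v : Fin n} (h : Ed ρ β ω ω' u v) :
    Ed ρ β ω ω' v u :=
  ⟨adj_symm h.1, fun hh => h.2.1 (up_symm hh), fun hh => h.2.2 (cl_symm hh)⟩

/-- The two-bite graph. -/
def TG (ρ β : Fin n → Fin r) (ω ω' : Mat r q) : SimpleGraph (Fin n) where
  Adj u v := Ed ρ β ω ω' u v ∨ Ed β ρ ω' ω u v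
  symm := ⟨fun _ _ h => h.imp Ed_symm Ed_symm⟩
  loopless := ⟨fun _ h => h.elim (fun h => adj_irrefl h.1) (fun h => adj_irrefl h.1)⟩

lemma adj_up {ω : Mat r q} {x y z : Fin r} (hx : y < x) (hz : z < x) (h1 : adj ω x y)
    (h2 : adj ω x z) : up ω y z := by
  refine ⟨x, hx, hz, ?_, ?_⟩
  · rcases h1 with h | h
    · exact h.2
    · exact absurd h.1 hx.not_gt
  · rcases h2 with h | h
    · exact h.2
    · exact absurd h.1 hz.not_gt

lemma no_mono {ρ β : Fin n → Fin r} {ω ω' : Mat r q} {u v w : Fin n} (h1 : Ed ρ β ω ω' u v)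
    (h2 : Ed ρ β ω ω' u w) (h3 : Ed ρ β ω ω' v w) : False := by
  have a1 := h1.1
  have a2 := h2.1
  have a3 := h3.1
  have n1 : ρ u ≠ ρ v := fun e => adj_irrefl (e ▸ a1)
  have n2 : ρ u ≠ ρ w := fun e => adj_irrefl (e ▸ a2)
  have n3 : ρ v ≠ ρ w := fun e => adj_irrefl (e ▸ a3)
  rcases lt_or_gt_of_ne n1 with l1 | l1
  · rcases lt_or_gt_of_ne n3 with l3 | l3
    · exact h1.2.1 (adj_up (l1.trans l3) l3 (adj_symm a2) (adj_symm a3))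
    · exact h2.2.1 (adj_up l1 l3 (adj_symm a1) a3)
  · rcases lt_or_gt_of_ne n2 with l2 | l2
    · exact h1.2.1 (adj_up l2 (l1.trans l2) (adj_symm a2) (adj_symm a3))
    · exact h3.2.1 (adj_up l1 l2 a1 a2)

lemma no_two {ρ β : Fin n → Fin r} {ω ω' : Mat r q} {u v w : Fin n} (h1 : Ed ρ β ω ω' u v)
    (h2 : Ed ρ β ω ω' u w) (h3 : Ed β ρ ω' ω v w) : False :=
  h3.2.2 ⟨ρ u, h1.1, h2.1⟩

lemma TG_free (ρ β : Fin n → Fin r) (ω ω' : Mat r q) : (TG ρ β ω ω').CliqueFree 3 := by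
  intro s hs
  rw [SimpleGraph.is3Clique_iff] at hs
  obtain ⟨u, v, w, h1, h2, h3, -⟩ := hs
  rcases h1 with h1 | h1 <;> rcases h2 with h2 | h2 <;> rcases h3 with h3 | h3
  · exact no_mono h1 h2 h3
  · exact no_two h1 h2 h3
  · exact no_two (Ed_symm h1) h3 h2
  · exact no_two (Ed_symm h2) (Ed_symm h3) h1
  · exact no_two (Ed_symm h2) (Ed_symm h3) h1
  · exact no_two (Ed_symm h1) h3 h2
  · exact no_two h1 h2 h3
  · exact no_mono h1 h2 h3

lemma deg_upper (ρ β : Fin n → Fin r) (ω ω' : Mat r q) (v : Fin n) :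
    cnt (fun u => (TG ρ β ω ω').Adj v u) ≤
      cnt (fun u => adj ω (ρ v) (ρ u)) + cnt (fun u => adj ω' (β v) (β u)) := by
  refine le_trans (cnt_mono fun u hu => ?_) (cnt_or _ _)
  exact hu.imp (fun h => h.1) (fun h => h.1)

lemma cnt_disj {ι : Type*} [Fintype ι] {s t w : ι → Prop} (h1 : ∀ i, s i → ¬ t i)
    (h2 : ∀ i, s i → w i) (h3 : ∀ i, t i → w i) : cnt s + cnt t ≤ cnt w := by
  classical
  rw [cnt_eq, cnt_eq, cnt_eq, ← card_union_of_disjoint]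
  · refine card_le_card fun i hi => ?_
    simp only [mem_union, mem_filter, mem_univ, true_and] at hi ⊢
    exact hi.elim (h2 i) (h3 i)
  · rw [Finset.disjoint_filter]
    exact fun i _ => h1 i

lemma one_lower (ρ β : Fin n → Fin r) (ω ω' : Mat r q) (v : Fin n) :
    cnt (fun u => adj ω (ρ v) (ρ u)) ≤
      cnt (fun u => Ed ρ β ω ω' v u ∧ ¬ adj ω' (β v) (β u)) +
      (cnt (fun u => adj ω (ρ v) (ρ u) ∧ up ω (ρ v) (ρ u)) +
      cnt (fun u => (cl ω' (β u) (β v) ∨ adj ω' (β u) (β v)) ∧ adj ω (ρ v) (ρ u))) := by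
  refine le_trans (cnt_mono fun u hu => ?_)
    ((cnt_or _ _).trans (Nat.add_le_add_left (cnt_or _ _) _))
  by_cases h1 : up ω (ρ v) (ρ u)
  · exact Or.inr (Or.inl ⟨hu, h1⟩)
  by_cases h2 : cl ω' (β u) (β v)
  · exact Or.inr (Or.inr ⟨Or.inl h2, hu⟩)
  by_cases h3 : adj ω' (β u) (β v)
  · exact Or.inr (Or.inr ⟨Or.inr h3, hu⟩)
  exact Or.inl ⟨⟨hu, h1, fun hh => h2 (cl_symm hh)⟩, fun hh => h3 (adj_symm hh)⟩

lemma deg_lower (ρ β : Fin n → Fin r) (ω ω' : Mat r q) (v : Fin n) :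
    cnt (fun u => Ed ρ β ω ω' v u ∧ ¬ adj ω' (β v) (β u)) +
    cnt (fun u => Ed β ρ ω' ω v u ∧ ¬ adj ω (ρ v) (ρ u)) ≤
      cnt (fun u => (TG ρ β ω ω').Adj v u) :=
  cnt_disj (fun _ h1 h2 => h1.2 h2.1.1) (fun _ h => Or.inl h.1) (fun _ h => Or.inr h.1)

lemma exists_enum (ρ : Fin n → Fin r) (s : Finset (Fin n)) (hs : a ≤ (s.image ρ).card) :
    ∃ v : Fin a → Fin n, (∀ i, v i ∈ s) ∧ Function.Injective (fun i => ρ (v i)) := by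
  classical
  obtain ⟨T, hT, hc⟩ := Finset.exists_subset_card_eq hs
  have h1 : ∀ y : T, ∃ u ∈ s, ρ u = y := fun y => by
    have := hT y.2
    simpa using this
  choose f hf1 hf2 using h1
  let e := (T.equivFinOfCardEq hc).symm
  refine ⟨fun i => f (e i), fun i => hf1 _, fun i j hij => ?_⟩
  simp only [hf2] at hij
  exact e.injective (Subtype.ext hij)

lemma indep_bad {ρ β : Fin n → Fin r} {ω ω' : Mat r q} {s : Finset (Fin n)}
    (hs : ∀ u ∈ s, ∀ v ∈ s, u ≠ v → ¬ Ed ρ β ω ω' u v) (hc : a ≤ (s.image ρ).card) :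
    ∃ v : Fin a → Fin n, IndepBad ρ β ω ω' v := by
  obtain ⟨v, hv1, hv2⟩ := exists_enum ρ s hc
  refine ⟨v, hv2, fun i j hlt h0 hcl => ?_⟩
  by_contra hup
  refine hs _ (hv1 i) _ (hv1 j) ?_ ⟨Or.inl ⟨hlt, h0⟩, hup, hcl⟩
  intro he
  rw [he] at hlt
  exact lt_irrefl _ hlt

namespace Par
variable (P : Par n r q a s0 h g p)
include P

theorem graph_exists : ∃ G : SimpleGraph (Fin n), G.CliqueFree 3 ∧
    (∀ s : Finset (Fin n), (∀ u ∈ s, ∀ v ∈ s, u ≠ v → ¬ G.Adj u v) → s.card < 10 * a) ∧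
    (∀ v, (cnt (fun u => G.Adj v u) : ℝ) ≤ 2 * (p * n) + 2 * h ^ 49) ∧
    (∀ v, 2 * (p * n) - 12 * h ^ 49 ≤ (cnt (fun u => G.Adj v u) : ℝ)) := by
  obtain ⟨ρ, β, hρ, hβ, hI⟩ := P.maps_exist
  obtain ⟨ω, ω', S, S'⟩ := P.pair_exists hρ hβ
  refine ⟨TG ρ β ω ω', TG_free _ _ _ _, fun s hs => ?_, fun v => ?_, fun v => ?_⟩
  · by_contra hcon
    push Not at hcon
    rcases hI s hcon with hc | hc
    · obtain ⟨v, hv⟩ := indep_bad (ρ := ρ) (β := β) (ω := ω) (ω' := ω')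
        (fun u hu v hv hne hE => hs u hu v hv hne (Or.inl hE)) (by convert hc)
      exact S.alpha v hv
    · obtain ⟨v, hv⟩ := indep_bad (ρ := β) (β := ρ) (ω := ω') (ω' := ω)
        (fun u hu v hv hne hE => hs u hu v hv hne (Or.inr hE)) (by convert hc)
      exact S'.alpha v hv
  · have h1 : (cnt (fun u => (TG ρ β ω ω').Adj v u) : ℝ) ≤
      cnt (fun u => adj ω (ρ v) (ρ u)) + cnt (fun u => adj ω' (β v) (β u)) := by
      exact_mod_cast deg_upper ρ β ω ω' v
    have := S.degU (ρ v)
    have := S'.degU (β v)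
    linarith
  · have h1 : (cnt (fun u => Ed ρ β ω ω' v u ∧ ¬ adj ω' (β v) (β u)) : ℝ) +
      cnt (fun u => Ed β ρ ω' ω v u ∧ ¬ adj ω (ρ v) (ρ u)) ≤
      cnt (fun u => (TG ρ β ω ω').Adj v u) := by exact_mod_cast deg_lower ρ β ω ω' v
    have h2 : (cnt (fun u => adj ω (ρ v) (ρ u)) : ℝ) ≤
      cnt (fun u => Ed ρ β ω ω' v u ∧ ¬ adj ω' (β v) (β u)) +
      (cnt (fun u => adj ω (ρ v) (ρ u) ∧ up ω (ρ v) (ρ u)) +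
      cnt (fun u => (cl ω' (β u) (β v) ∨ adj ω' (β u) (β v)) ∧ adj ω (ρ v) (ρ u))) := by
      exact_mod_cast one_lower ρ β ω ω' v
    have h3 : (cnt (fun u => adj ω' (β v) (β u)) : ℝ) ≤
      cnt (fun u => Ed β ρ ω' ω v u ∧ ¬ adj ω (ρ v) (ρ u)) +
      (cnt (fun u => adj ω' (β v) (β u) ∧ up ω' (β v) (β u)) +
      cnt (fun u => (cl ω (ρ u) (ρ v) ∨ adj ω (ρ u) (ρ v)) ∧ adj ω' (β v) (β u))) := by
      exact_mod_cast one_lower β ρ ω' ω v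
    have := S.degL (ρ v)
    have := S'.degL (β v)
    have := S.tri (ρ v)
    have := S'.tri (β v)
    have := S.cross v
    have := S'.cross v
    linarith

end Par
end TwoBites
end


noncomputable section

namespace TwoBites

open Finset

lemma half_floor {x : ℝ} (hx : 1 ≤ x) : x / 2 ≤ (⌊x⌋₊ : ℝ) := by
  have h1 : (1 : ℝ) ≤ ⌊x⌋₊ := by
    have : 1 ≤ ⌊x⌋₊ := (Nat.one_le_floor_iff x).2 hx
    exact_mod_cast this
  have := Nat.lt_floor_add_one x
  linarith

lemma par_exists {n : ℕ} {h g : ℝ} (hn : (n : ℝ) = h ^ 100) (hg : (n : ℝ) = Real.exp (g ^ 2))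
    (g1 : 1 ≤ g) (gh : 10 ^ 20 * g ^ 4 ≤ h) :
    ∃ (r q a s0 : ℕ) (p : ℝ), Par n r q a s0 h g p := by
  have gg : g ≤ g ^ 4 := by
    calc g = g ^ 1 := (pow_one g).symm
      _ ≤ g ^ 4 := pow_le_pow_right₀ g1 (by norm_num)
  have h1 : 1 ≤ h := by nlinarith
  have hh : h ≤ h ^ 50 := by
    calc h = h ^ 1 := (pow_one h).symm
      _ ≤ h ^ 50 := pow_le_pow_right₀ h1 (by norm_num)
  have g0 : 0 < g := by linarith
  have z1 : 1 ≤ h ^ 50 / g := by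
    rw [le_div_iff₀ g0]; nlinarith
  have k1 := half_floor z1
  have k2 : (⌊h ^ 50 / g⌋₊ : ℝ) ≤ h ^ 50 / g := Nat.floor_le (by linarith)
  have k0 : 1 ≤ ⌊h ^ 50 / g⌋₊ := (Nat.one_le_floor_iff _).2 z1
  set k := ⌊h ^ 50 / g⌋₊ with hk
  have k0' : (0 : ℝ) < k := by exact_mod_cast k0
  have e96 : 1 ≤ h ^ 96 := one_le_pow₀ h1
  have e45 : 1 ≤ h ^ 45 := one_le_pow₀ h1
  have e50 : 1 ≤ h ^ 50 := one_le_pow₀ h1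
  have ge : 1 ≤ g * h ^ 50 := by nlinarith
  rw [le_div_iff₀ g0] at k2
  rw [div_right_comm, div_le_iff₀ g0] at k1
  refine ⟨⌊h ^ 96⌋₊, k - 1, ⌈10 ^ 6 * g * h ^ 50⌉₊, ⌊h ^ 45⌋₊, 1 / k, ?_⟩
  refine ⟨?_, hn, hg, g1, gh, half_floor e96, Nat.floor_le (by linarith), ?_, ?_,
    Nat.le_ceil _, ?_, half_floor e45, Nat.floor_le (by linarith)⟩
  · rw [Nat.cast_sub k0]; simp
  · rw [one_div, inv_mul_eq_div, le_div_iff₀ k0']; linarith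
  · rw [one_div, inv_mul_eq_div, div_le_iff₀ k0']; linarith
  · have := Nat.ceil_lt_add_one (a := 10 ^ 6 * g * h ^ 50) (by positivity)
    nlinarith

lemma hg_exists (K : ℝ) : ∃ N : ℕ, ∀ n : ℕ, N ≤ n → ∃ h g : ℝ, (n : ℝ) = h ^ 100 ∧
    (n : ℝ) = Real.exp (g ^ 2) ∧ 1 ≤ g ∧ K * g ^ 4 ≤ h ∧ 0 < h ∧ Real.log n = g ^ 2 := by
  have ho := (isLittleO_log_rpow_rpow_atTop (s := 1 / 100) 2 (by norm_num)).bound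
    (c := 1 / (|K| + 1)) (by positivity)
  have ho' := (tendsto_natCast_atTop_atTop (R := ℝ)).eventually ho
  obtain ⟨N, hN⟩ := Filter.eventually_atTop.1 ho'
  refine ⟨max N 3, fun n hn => ?_⟩
  have hb := hN n (le_trans (le_max_left _ _) hn)
  have n3 : (3 : ℝ) ≤ n := by exact_mod_cast le_trans (le_max_right _ _) hn
  have n0 : (0 : ℝ) < n := by linarith
  have l1 : 1 ≤ Real.log n := by
    rw [Real.le_log_iff_exp_le n0]
    have := Real.exp_one_lt_d9; linarith
  have sq : Real.sqrt (Real.log n) ^ 2 = Real.log n := Real.sq_sqrt (by linarith)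
  refine ⟨(n : ℝ) ^ (1 / 100 : ℝ), Real.sqrt (Real.log n), ?_, ?_, ?_, ?_, by positivity, sq.symm⟩
  · rw [← Real.rpow_natCast, ← Real.rpow_mul n0.le]; norm_num
  · rw [sq, Real.exp_log n0]
  · exact Real.one_le_sqrt.2 l1
  · have e4 : Real.sqrt (Real.log n) ^ 4 = Real.log n ^ 2 := by
      rw [← sq, ← pow_mul]; congr 1; rw [sq]
    rw [e4]
    rw [Real.norm_of_nonneg (by positivity), Real.norm_of_nonneg (by positivity),
      one_div_mul_eq_div, le_div_iff₀ (by positivity)] at hb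
    have e2 : Real.log n ^ (2 : ℝ) = Real.log n ^ 2 := by
      rw [← Real.rpow_natCast]; norm_num
    rw [e2] at hb
    have := le_abs_self K
    nlinarith [sq_nonneg (Real.log n)]

lemma degree_cnt {n : ℕ} (G : SimpleGraph (Fin n)) [DecidableRel G.Adj] (v : Fin n) :
    G.degree v = cnt (fun u => G.Adj v u) := by
  rw [cnt_eq, ← SimpleGraph.card_neighborFinset_eq_degree, SimpleGraph.neighborFinset_eq_filter]

theorem main :
    ∃ C : ℝ, 0 < C ∧ ∀ ε : ℝ, 0 < ε → ∃ N : ℕ, ∀ n : ℕ, N ≤ n →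
      ∃ (G : SimpleGraph (Fin n)) (_ : DecidableRel G.Adj),
        G.CliqueFree 3 ∧
        (∀ s : Finset (Fin n), (∀ u ∈ s, ∀ v ∈ s, u ≠ v → ¬ G.Adj u v) →
          (s.card : ℝ) ≤ C * Real.sqrt (n * Real.log n)) ∧
        (G.maxDegree : ℝ) ≤ C * Real.sqrt (n * Real.log n) ∧
        (G.maxDegree : ℝ) - (G.minDegree : ℝ) ≤ ε * Real.sqrt (n / Real.log n) := by
  refine ⟨3 * 10 ^ 7, by norm_num, fun ε hε => ?_⟩
  obtain ⟨N, hN⟩ := hg_exists (max (10 ^ 20) (14 / ε))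
  refine ⟨N, fun n hn => ?_⟩
  obtain ⟨h, g, e1, e2, g1, gh, h0, el⟩ := hN n hn
  have g40 : 0 ≤ g ^ 4 := by positivity
  have gh1 : 10 ^ 20 * g ^ 4 ≤ h := le_trans (mul_le_mul_of_nonneg_right (le_max_left _ _) g40) gh
  have gh2 : 14 / ε * g ^ 4 ≤ h := le_trans (mul_le_mul_of_nonneg_right (le_max_right _ _) g40) gh
  obtain ⟨r, q, a, s0, p, P⟩ := par_exists e1 e2 g1 gh1
  obtain ⟨G, c1, c2, c3, c4⟩ := P.graph_exists
  classical
  have g0 : 0 < g := by linarith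
  have h1 : 1 ≤ h := by have := P.h1; linarith
  have r1 : Real.sqrt (n * Real.log n) = h ^ 50 * g := by
    rw [el, e1, show h ^ 100 * g ^ 2 = (h ^ 50 * g) ^ 2 by ring, Real.sqrt_sq (by positivity)]
  have r2 : Real.sqrt (n / Real.log n) = h ^ 50 / g := by
    rw [el, e1, show h ^ 100 / g ^ 2 = (h ^ 50 / g) ^ 2 by rw [div_pow]; ring,
      Real.sqrt_sq (by positivity)]
  have n0 : 0 < n := by
    have : (0 : ℝ) < n := by rw [e1]; positivity
    exact_mod_cast this
  haveI : Nonempty (Fin n) := ⟨⟨0, n0⟩⟩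
  obtain ⟨x, hx⟩ := G.exists_maximal_degree_vertex
  obtain ⟨y, hy⟩ := G.exists_minimal_degree_vertex
  have dx := c3 x
  have dy := c4 y
  rw [← degree_cnt, ← hx] at dx
  rw [← degree_cnt, ← hy] at dy
  have e49 : h ^ 49 ≤ h ^ 50 := pow_le_pow_right₀ h1 (by norm_num)
  have e50 : h ^ 50 ≤ h ^ 50 * g := le_mul_of_one_le_right (by positivity) g1
  refine ⟨G, inferInstance, c1, fun s hs => ?_, ?_, ?_⟩
  · have := c2 s hs
    have : (s.card : ℝ) ≤ 10 * a := by exact_mod_cast this.le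
    have := P.a2
    rw [r1]
    nlinarith
  · rw [r1]
    have := P.p_n
    nlinarith
  · rw [r2]
    have gg : g ≤ g ^ 4 := by
      calc g = g ^ 1 := (pow_one g).symm
        _ ≤ g ^ 4 := pow_le_pow_right₀ g1 (by norm_num)
    have k1 : 14 * g ≤ ε * h := by
      have : 14 / ε * g ≤ h := le_trans (mul_le_mul_of_nonneg_left gg (by positivity)) gh2
      rw [div_mul_eq_mul_div, div_le_iff₀ hε] at this
      linarith
    have k2 : 14 * h ^ 49 ≤ ε * (h ^ 50 / g) := by
      rw [← mul_div_assoc, le_div_iff₀ g0]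
      have := mul_le_mul_of_nonneg_right k1 (by positivity : 0 ≤ h ^ 49)
      calc 14 * h ^ 49 * g = 14 * g * h ^ 49 := by ring
        _ ≤ ε * h * h ^ 49 := this
        _ = ε * h ^ 50 := by ring
    linarith

end TwoBites

end


/-- A deterministic consequence of Bohman's analysis of the triangle-free process:
there is constant `C > 0` so that for every `ε > 0` and every sufficiently large `n`,
there is a triangle-free graph on `n` vertices with independence number at most
`C√(n log n)`, maximum degree at most `C√(n log n)`, and degree spread at most
`ε√(n / log n)`. -/
theorem bohman_almost_regular :
    ∃ C : ℝ, 0 < C ∧ ∀ ε : ℝ, 0 < ε → ∃ N : ℕ, ∀ n : ℕ, N ≤ n →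
      ∃ (G : SimpleGraph (Fin n)) (_ : DecidableRel G.Adj),
        G.CliqueFree 3 ∧
        (∀ s : Finset (Fin n), (∀ u ∈ s, ∀ v ∈ s, u ≠ v → ¬ G.Adj u v) →
          (s.card : ℝ) ≤ C * Real.sqrt (n * Real.log n)) ∧
        (G.maxDegree : ℝ) ≤ C * Real.sqrt (n * Real.log n) ∧
        (G.maxDegree : ℝ) - (G.minDegree : ℝ) ≤ ε * Real.sqrt (n / Real.log n) := by
  exact TwoBites.main
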